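/- arXiv:1406.6335 — 3 statements merged into one kernel-verified Lean document; each statement's English description precedes it below -/
import Mathlib

section
/- Let A be a unital Archimedean f-algebra with point separating order dual A^~. Then the Arens homomorphism m : Z(A)'' → Z(A^~) of the bidual of the ideal center Z(A) is surjective onto the ideal center Z(A^~) of the order dual A^~. -/
noncomputable section

open Set

/-- A map between preordered sets is *order bounded* if it maps order intervals into
order intervals. -/
def IsOrdBdd {E F : Type*} [Preorder E] [Preorder F] (f : E → F) : Prop :=
  ∀ a b : E, ∃ c d : F, ∀ x : E, a ≤ x → x ≤ b → c ≤ f x ∧ f x ≤ d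

/-- A map of a Riesz space is *band preserving* if it preserves disjointness. -/
def IsBandPres {E : Type*} [Lattice E] [AddCommGroup E] (T : E → E) : Prop :=
  ∀ x y : E, |x| ⊓ |y| = 0 → |T x| ⊓ |y| = 0

/-- An *orthomorphism*: an order bounded, band preserving linear map. -/
def IsOrtho {E : Type*} [Lattice E] [AddCommGroup E] [Module ℝ E] (T : E → E) : Prop :=
  IsLinearMap ℝ T ∧ IsOrdBdd T ∧ IsBandPres T

/-- A member of the *ideal center* `Z(E)`: an orthomorphism dominated by a multiple of the
identity. -/
def IsCentral {E : Type*} [Lattice E] [AddCommGroup E] [Module ℝ E] (T : E → E) : Prop :=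
  IsOrtho T ∧ ∃ c : ℝ, ∀ x : E, 0 ≤ x → -(c • x) ≤ T x ∧ T x ≤ c • x

/-- Order continuity of a real functional: it converges to `0` along every downward
directed system with infimum `0`. -/
def IsOrderContinuousFun {X : Type*} [Lattice X] [AddCommGroup X] (φ : X → ℝ) : Prop :=
  ∀ s : Set X, s.Nonempty → DirectedOn (· ≥ ·) s → IsGLB s 0 →
    ∀ ε : ℝ, 0 < ε → ∃ x ∈ s, ∀ y ∈ s, y ≤ x → |φ y| < ε

/-- `p` realizes the Riesz space `D` as the order dual `E^∼` of `E`. -/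
structure IsOrderDual (E D : Type*) [Lattice E] [AddCommGroup E] [Module ℝ E]
    [Lattice D] [AddCommGroup D] [Module ℝ D] (p : D → E → ℝ) : Prop where
  lin_fun : ∀ f : D, IsLinearMap ℝ (p f)
  lin_vec : ∀ x : E, IsLinearMap ℝ fun f => p f x
  bdd : ∀ f : D, IsOrdBdd (p f)
  inj : ∀ f g : D, (∀ x, p f x = p g x) → f = g
  surj : ∀ φ : E → ℝ, IsLinearMap ℝ φ → IsOrdBdd φ → ∃ f : D, ∀ x, p f x = φ x
  le_iff : ∀ f g : D, f ≤ g ↔ ∀ x : E, 0 ≤ x → p f x ≤ p g x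

/-- `p` realizes the Riesz space `B` as the order continuous order dual `(X^∼)ₙ` of `X`
(used for `X = A^∼`, giving `B = (A^∼)ₙ^∼`). -/
structure IsOrderContinuousDual (X B : Type*) [Lattice X] [AddCommGroup X] [Module ℝ X]
    [Lattice B] [AddCommGroup B] [Module ℝ B] (p : B → X → ℝ) : Prop where
  lin_fun : ∀ F : B, IsLinearMap ℝ (p F)
  lin_vec : ∀ f : X, IsLinearMap ℝ fun F => p F f
  bdd : ∀ F : B, IsOrdBdd (p F)
  cont : ∀ F : B, IsOrderContinuousFun (p F)
  inj : ∀ F G : B, (∀ f, p F f = p G f) → F = G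
  surj : ∀ φ : X → ℝ, IsLinearMap ℝ φ → IsOrdBdd φ → IsOrderContinuousFun φ →
    ∃ F : B, ∀ f, p F f = φ f
  le_iff : ∀ F G : B, F ≤ G ↔ ∀ f : X, 0 ≤ f → p F f ≤ p G f

/-- `ρ` realizes the lattice-ordered algebra `O` as the `f`-algebra `Orth(E)` of all
orthomorphisms of `E`. -/
structure IsOrthAlg (E O : Type*) [Lattice E] [AddCommGroup E] [Module ℝ E]
    [Lattice O] [Ring O] [Module ℝ O] (ρ : O → E → E) : Prop where
  ortho : ∀ a : O, IsOrtho (ρ a)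
  lin_vec : ∀ x : E, IsLinearMap ℝ fun a => ρ a x
  map_one : ∀ x : E, ρ 1 x = x
  map_mul : ∀ (a b : O) (x : E), ρ (a * b) x = ρ a (ρ b x)
  inj : ∀ a b : O, (∀ x, ρ a x = ρ b x) → a = b
  surj : ∀ T : E → E, IsOrtho T → ∃ a : O, ∀ x, ρ a x = T x
  le_iff : ∀ a b : O, a ≤ b ↔ ∀ x : E, 0 ≤ x → ρ a x ≤ ρ b x

/-- `ρ` realizes the normed lattice-ordered algebra `Z` as the ideal center `Z(E)` of `E`,
an AM-space whose norm is the order unit norm (the order/algebra unit being `id`). -/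
structure IsCenterOf (E Z : Type*) [Lattice E] [AddCommGroup E] [Module ℝ E]
    [Lattice Z] [NormedRing Z] [NormedAlgebra ℝ Z] (ρ : Z → E → E) : Prop where
  central : ∀ a : Z, IsCentral (ρ a)
  lin_vec : ∀ x : E, IsLinearMap ℝ fun a => ρ a x
  map_one : ∀ x : E, ρ 1 x = x
  map_mul : ∀ (a b : Z) (x : E), ρ (a * b) x = ρ a (ρ b x)
  inj : ∀ a b : Z, (∀ x, ρ a x = ρ b x) → a = b
  surj : ∀ T : E → E, IsCentral T → ∃ a : Z, ∀ x, ρ a x = T x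
  le_iff : ∀ a b : Z, a ≤ b ↔ ∀ x : E, 0 ≤ x → ρ a x ≤ ρ b x
  norm_le_iff : ∀ (a : Z) (c : ℝ), 0 ≤ c →
    (‖a‖ ≤ c ↔ ∀ x : E, 0 ≤ x → -(c • x) ≤ ρ a x ∧ ρ a x ≤ c • x)

/-- The pairing `p : D → E → ℝ` separates the points of `E`. -/
def SepPoints {E D : Type*} [Zero E] (p : D → E → ℝ) : Prop :=
  ∀ x : E, (∀ f : D, p f x = 0) → x = 0

/-- `y` belongs to the `σ(E,D)`-closure of `s ⊆ E`, for the pairing `p : D → E → ℝ`. -/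
def InWeakClosure {E D : Type*} (p : D → E → ℝ) (s : Set E) (y : E) : Prop :=
  ∀ (fs : Finset D) (ε : ℝ), 0 < ε → ∃ z ∈ s, ∀ f ∈ fs, |p f z - p f y| < ε

/-- `E` has a *topologically full center*: for each `x ∈ E₊` the `σ(E,E^∼)`-closure of
`Z(E)x` contains the order ideal generated by `x`.  Here `p : D → E → ℝ` is the duality
with `E^∼` and `ρ : Z → E → E` is the action of the ideal center. -/
def TopFullCenter {E D Z : Type*} [Lattice E] [AddCommGroup E] [Module ℝ E]
    (p : D → E → ℝ) (ρ : Z → E → E) : Prop :=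
  ∀ x : E, 0 ≤ x → ∀ y : E, (∃ c : ℝ, 0 ≤ c ∧ |y| ≤ c • x) →
    InWeakClosure p {z | ∃ T : Z, ρ T x = z} y

/-- `FG` is the Arens product `F ⬝ G` in the order bidual `B` of the algebra `A`:
`(F⬝G)(f) = F(G⬝f)`, `(G⬝f)(a) = G(f⬝a)`, `(f⬝a)(b) = f(ab)`; `pA : DA → A → ℝ` is the
duality of `A` with `A^∼` and `pB : B → DA → ℝ` that of `(A^∼)ₙ^∼` with `A^∼`. -/
def IsArensProduct {A DA B : Type*} [Mul A] (pA : DA → A → ℝ) (pB : B → DA → ℝ)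
    (F G FG : B) : Prop :=
  ∀ f Gf : DA,
    (∀ (a : A) (fa : DA), (∀ b : A, pA fa b = pA f (a * b)) → pA Gf a = pB G fa) →
    pB FG f = pB F Gf

/-- The ring structure of `B` is the Arens multiplication inherited from `A`, with unit the
canonical image of `1 ∈ A`. -/
structure IsArensAlgebra {A DA B : Type*} [Monoid A] [Ring B]
    (pA : DA → A → ℝ) (pB : B → DA → ℝ) : Prop where
  mul_def : ∀ F G : B, IsArensProduct pA pB F G (F * G)
  one_def : ∀ f : DA, pB 1 f = pA f 1

section NormedArens

variable (Z : Type*) [NormedRing Z] [NormedAlgebra ℝ Z]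

/-- First step of the Arens construction: `f ⬝ a` for `f ∈ Z'`, `a ∈ Z`:
`(f⬝a)(b) = f(ab)`. -/
def arensDot (f : Z →L[ℝ] ℝ) (a : Z) : Z →L[ℝ] ℝ :=
  f.comp (ContinuousLinearMap.mul ℝ Z a)

/-- `a ↦ f ⬝ a` as a continuous linear map. -/
def arensDotL (f : Z →L[ℝ] ℝ) : Z →L[ℝ] Z →L[ℝ] ℝ :=
  (ContinuousLinearMap.compL ℝ Z Z ℝ f).comp (ContinuousLinearMap.mul ℝ Z)

/-- Second step of the Arens construction: `F ⬝ f` for `F ∈ Z''`, `f ∈ Z'`: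
`(F⬝f)(a) = F(f⬝a)`. -/
def arensFDot (F : (Z →L[ℝ] ℝ) →L[ℝ] ℝ) (f : Z →L[ℝ] ℝ) : Z →L[ℝ] ℝ :=
  F.comp (arensDotL Z f)

/-- `f ↦ f ⬝ ·` as a continuous linear map. -/
def arensDotLL : (Z →L[ℝ] ℝ) →L[ℝ] Z →L[ℝ] Z →L[ℝ] ℝ :=
  ((ContinuousLinearMap.compL ℝ Z (Z →L[ℝ] Z) (Z →L[ℝ] ℝ)).flip
      (ContinuousLinearMap.mul ℝ Z)).comp (ContinuousLinearMap.compL ℝ Z Z ℝ)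

/-- `f ↦ F ⬝ f` as a continuous linear map. -/
def arensFDotL (F : (Z →L[ℝ] ℝ) →L[ℝ] ℝ) : (Z →L[ℝ] ℝ) →L[ℝ] Z →L[ℝ] ℝ :=
  (ContinuousLinearMap.compL ℝ Z (Z →L[ℝ] ℝ) ℝ F).comp (arensDotLL Z)

/-- The *Arens product* on the norm bidual `Z''`: `(F⬝G)(f) = F(G⬝f)`. -/
def arensMul (F G : (Z →L[ℝ] ℝ) →L[ℝ] ℝ) : (Z →L[ℝ] ℝ) →L[ℝ] ℝ :=
  F.comp (arensFDotL Z G)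

/-- The canonical image of `1 ∈ Z` in the bidual `Z''`; it is the unit for the Arens
product. -/
def arensOne : (Z →L[ℝ] ℝ) →L[ℝ] ℝ := ContinuousLinearMap.apply ℝ ℝ (1 : Z)

end NormedArens

section DualOrder

variable {Z : Type*} [Lattice Z] [NormedRing Z] [NormedAlgebra ℝ Z]

/-- Positivity of a functional in `Z'`. -/
def dualNonneg (μ : Z →L[ℝ] ℝ) : Prop := ∀ a : Z, 0 ≤ a → 0 ≤ μ a

/-- The canonical order of the bidual `Z''`. -/
def bidualLe (F G : (Z →L[ℝ] ℝ) →L[ℝ] ℝ) : Prop :=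
  ∀ μ : Z →L[ℝ] ℝ, dualNonneg μ → F μ ≤ G μ

/-- `H = F ⊔ G` in the bidual `Z''`. -/
def IsBidualSup (F G H : (Z →L[ℝ] ℝ) →L[ℝ] ℝ) : Prop :=
  bidualLe F H ∧ bidualLe G H ∧
    ∀ K : (Z →L[ℝ] ℝ) →L[ℝ] ℝ, bidualLe F K → bidualLe G K → bidualLe H K

/-- `s ⊆ Z''` is downward directed with infimum `0`. -/
def BidualDownTo0 (s : Set ((Z →L[ℝ] ℝ) →L[ℝ] ℝ)) : Prop :=
  s.Nonempty ∧ (∀ F ∈ s, ∀ G ∈ s, ∃ H ∈ s, bidualLe H F ∧ bidualLe H G) ∧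
    (∀ F ∈ s, bidualLe 0 F) ∧ ∀ K, (∀ F ∈ s, bidualLe K F) → bidualLe K 0

/-- The Riesz–Kantorovich formula for `|μ|(a)`, `μ ∈ Z'`, `a ∈ Z₊`. -/
def dualAbs (μ : Z →L[ℝ] ℝ) (a : Z) : ℝ := sSup ((fun b => μ b) '' {b : Z | |b| ≤ a})

/-- Disjointness `|μ| ⊓ |ν| = 0` in `Z'`. -/
def DualDisjoint (μ ν : Z →L[ℝ] ℝ) : Prop :=
  ∀ a : Z, 0 ≤ a → ∀ ε : ℝ, 0 < ε →
    ∃ b c : Z, 0 ≤ b ∧ 0 ≤ c ∧ b + c = a ∧ dualAbs μ b + dualAbs ν c < ε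

/-- The Riesz–Kantorovich formula for `|F|(μ)`, `F ∈ Z''`, `μ ∈ Z'₊`. -/
def bidualAbs (F : (Z →L[ℝ] ℝ) →L[ℝ] ℝ) (μ : Z →L[ℝ] ℝ) : ℝ :=
  sSup ((fun ν => F ν) '' {ν : Z →L[ℝ] ℝ | ∀ a : Z, 0 ≤ a → dualAbs ν a ≤ μ a})

/-- Disjointness `|F| ⊓ |G| = 0` in `Z''`. -/
def BidualDisjoint (F G : (Z →L[ℝ] ℝ) →L[ℝ] ℝ) : Prop :=
  ∀ μ : Z →L[ℝ] ℝ, dualNonneg μ → ∀ ε : ℝ, 0 < ε →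
    ∃ μ₁ μ₂ : Z →L[ℝ] ℝ, dualNonneg μ₁ ∧ dualNonneg μ₂ ∧ μ₁ + μ₂ = μ ∧
      bidualAbs F μ₁ + bidualAbs G μ₂ < ε

end DualOrder

/-- A member of the ideal center `Z(J)` of an order ideal `J` of a Riesz space, encoded as a
map defined on the ambient space whose restriction to `J` is the actual operator. -/
def IsCentralOn {D : Type*} [Lattice D] [AddCommGroup D] [Module ℝ D]
    (J : Set D) (S : D → D) : Prop :=
  (∀ f ∈ J, S f ∈ J) ∧ (∀ f ∈ J, ∀ g ∈ J, S (f + g) = S f + S g) ∧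
    (∀ (c : ℝ), ∀ f ∈ J, S (c • f) = c • S f) ∧
    ∃ c : ℝ, ∀ f ∈ J, 0 ≤ f → -(c • f) ≤ S f ∧ S f ≤ c • f

end

section RieszSpace

variable {E : Type*} [Lattice E] [AddCommGroup E] [Module ℝ E]
  [CovariantClass E E (· + ·) (· ≤ ·)] [PosSMulMono ℝ E]
  {F : Type*} [Lattice F] [AddCommGroup F] [Module ℝ F]
  [CovariantClass F F (· + ·) (· ≤ ·)] [PosSMulMono ℝ F]

lemma smul_mono_scalar {r s : ℝ} (h : r ≤ s) {x : E} (hx : 0 ≤ x) : r • x ≤ s • x := by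
  rw [← sub_nonneg, ← sub_smul]
  exact smul_nonneg (sub_nonneg.2 h) hx

lemma map_real_smul_of_nonneg (harch : ∀ x y : F, (∀ n : ℕ, (n : ℝ) • x ≤ y) → x ≤ 0)
    {M : E →+ F} (hM : ∀ x, 0 ≤ x → 0 ≤ M x) {r : ℝ} (hr : 0 ≤ r) {y : E} (hy : 0 ≤ y) :
    M (r • y) = r • M y := by
  have hmono : ∀ a b, a ≤ b → M a ≤ M b := fun a b h => by
    rw [← sub_nonneg, ← map_sub]
    exact hM _ (sub_nonneg.2 h)
  have hnat : ∀ (k : ℕ) (z : E), M ((k : ℝ) • z) = (k : ℝ) • M z := fun k z => by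
    rw [Nat.cast_smul_eq_nsmul, Nat.cast_smul_eq_nsmul, map_nsmul]
  have key : ∀ n : ℕ, ∃ k : ℕ, (k : ℝ) • M y ≤ (n : ℝ) • M (r • y) ∧
      (n : ℝ) • M (r • y) ≤ ((k : ℝ) + 1) • M y ∧
      (k : ℝ) • M y ≤ (n : ℝ) • r • M y ∧ (n : ℝ) • r • M y ≤ ((k : ℝ) + 1) • M y := by
    intro n
    have h1 : (⌊(n : ℝ) * r⌋₊ : ℝ) ≤ n * r := Nat.floor_le (by positivity)
    have h2 : (n : ℝ) * r ≤ (⌊(n : ℝ) * r⌋₊ : ℝ) + 1 := (Nat.lt_floor_add_one _).le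
    refine ⟨⌊(n : ℝ) * r⌋₊, ?_, ?_, ?_, ?_⟩
    · rw [← hnat, ← hnat, smul_smul]
      exact hmono _ _ (smul_mono_scalar h1 hy)
    · have := hnat (⌊(n : ℝ) * r⌋₊ + 1) y
      push_cast at this
      rw [← hnat, ← this, smul_smul]
      exact hmono _ _ (smul_mono_scalar h2 hy)
    · rw [smul_smul]
      exact smul_mono_scalar h1 (hM _ hy)
    · rw [smul_smul]
      exact smul_mono_scalar h2 (hM _ hy)
  refine le_antisymm (sub_nonpos.1 (harch _ (M y) fun n => ?_))
    (sub_nonpos.1 (harch _ (M y) fun n => ?_))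
  · obtain ⟨k, -, h2, h3, -⟩ := key n
    rw [smul_sub, sub_le_iff_le_add]
    calc _ ≤ ((k : ℝ) + 1) • M y := h2
      _ = M y + (k : ℝ) • M y := by rw [add_smul, one_smul, add_comm]
      _ ≤ _ := by gcongr
  · obtain ⟨k, h1, -, -, h4⟩ := key n
    rw [smul_sub, sub_le_iff_le_add]
    calc _ ≤ ((k : ℝ) + 1) • M y := h4
      _ = M y + (k : ℝ) • M y := by rw [add_smul, one_smul, add_comm]
      _ ≤ _ := by gcongr

/-- A positive additive map into an Archimedean Riesz space is homogeneous. -/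
lemma map_real_smul_of_positive
    (harch : ∀ x y : F, (∀ n : ℕ, (n : ℝ) • x ≤ y) → x ≤ 0)
    {M : E →+ F} (hM : ∀ x, 0 ≤ x → 0 ≤ M x) (r : ℝ) (y : E) :
    M (r • y) = r • M y := by
  have h1 : ∀ {s : ℝ}, 0 ≤ s → ∀ z : E, M (s • z) = s • M z := fun {s} hs z => by
    rw [← posPart_sub_negPart z, smul_sub, map_sub, map_sub, smul_sub,
      map_real_smul_of_nonneg harch hM hs (posPart_nonneg z),
      map_real_smul_of_nonneg harch hM hs (negPart_nonneg z)]
  rcases le_total 0 r with hr | hr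
  · exact h1 hr y
  · have := h1 (neg_nonneg.2 hr) y
    rwa [neg_smul, neg_smul, map_neg, neg_inj] at this

omit [PosSMulMono ℝ E] in
/-- Two-sided domination by a multiple of the identity on the positive cone extends to
domination in absolute value. -/
lemma abs_map_le_smul_abs (T : E →+ E) {c : ℝ}
    (hT : ∀ x, 0 ≤ x → -(c • x) ≤ T x ∧ T x ≤ c • x) (x : E) : |T x| ≤ c • |x| := by
  have habs : ∀ z, 0 ≤ z → |T z| ≤ c • z := fun z hz =>
    abs_le'.2 ⟨(hT z hz).2, neg_le.1 (hT z hz).1⟩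
  calc |T x| = |T x⁺ + -T x⁻| := by
        rw [← sub_eq_add_neg, ← map_sub, posPart_sub_negPart]
    _ ≤ |T x⁺| + |-T x⁻| := abs_add_le _ _
    _ ≤ c • x⁺ + c • x⁻ := by
        rw [abs_neg]
        exact add_le_add (habs _ (posPart_nonneg x)) (habs _ (negPart_nonneg x))
    _ = c • |x| := by rw [← smul_add, posPart_add_negPart]

lemma isOrdBdd_of_abs_le (T : E →+ E) {c : ℝ} (hc : 0 ≤ c) (hT : ∀ x, |T x| ≤ c • |x|) :
    IsOrdBdd T := by
  intro a b
  refine ⟨-(c • (|a| + |b|)), c • (|a| + |b|), fun x ha hb => ?_⟩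
  have h : |x| ≤ |a| + |b| := abs_le'.2
    ⟨hb.trans ((le_abs_self b).trans (le_add_of_nonneg_left (abs_nonneg a))),
      (neg_le_neg_iff.2 ha).trans ((neg_le_abs a).trans (le_add_of_nonneg_right (abs_nonneg b)))⟩
  have h' := (hT x).trans (smul_le_smul_of_nonneg_left h hc)
  exact ⟨neg_le.1 ((neg_le_abs _).trans h'), (le_abs_self _).trans h'⟩

end RieszSpace

section UnitalFAlgebra

variable {A : Type*} [Lattice A] [Ring A] [Module ℝ A]
  [CovariantClass A A (· + ·) (· ≤ ·)] [PosSMulMono ℝ A]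

lemma mul_real_smul (hpos : ∀ a b : A, 0 ≤ a → 0 ≤ b → 0 ≤ a * b)
    (harch : ∀ x y : A, (∀ n : ℕ, (n : ℝ) • x ≤ y) → x ≤ 0) (r : ℝ) (x y : A) :
    x * r • y = r • (x * y) := by
  have h : ∀ z : A, 0 ≤ z → z * r • y = r • (z * y) := fun z hz =>
    map_real_smul_of_positive harch (M := AddMonoidHom.mulLeft z)
      (fun _ h => hpos _ _ hz h) r y
  rw [← posPart_sub_negPart x, sub_mul, sub_mul, smul_sub, h _ (posPart_nonneg x),
    h _ (negPart_nonneg x)]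

lemma real_smul_mul (hpos : ∀ a b : A, 0 ≤ a → 0 ≤ b → 0 ≤ a * b)
    (harch : ∀ x y : A, (∀ n : ℕ, (n : ℝ) • x ≤ y) → x ≤ 0) (r : ℝ) (x y : A) :
    (r • x) * y = r • (x * y) := by
  have h : ∀ z : A, 0 ≤ z → (r • x) * z = r • (x * z) := fun z hz =>
    map_real_smul_of_positive harch (M := AddMonoidHom.mulRight z)
      (fun _ h => hpos _ _ h hz) r x
  rw [← posPart_sub_negPart y, mul_sub, mul_sub, smul_sub, h _ (posPart_nonneg y),
    h _ (negPart_nonneg y)]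

omit [Module ℝ A] [PosSMulMono ℝ A] in
lemma mul_le_mul_left_of_pos (hpos : ∀ a b : A, 0 ≤ a → 0 ≤ b → 0 ≤ a * b)
    {a b c : A} (hab : a ≤ b) (hc : 0 ≤ c) : c * a ≤ c * b := by
  rw [← sub_nonneg, ← mul_sub]
  exact hpos _ _ hc (sub_nonneg.2 hab)

omit [Module ℝ A] [PosSMulMono ℝ A] in
lemma mul_le_mul_right_of_pos (hpos : ∀ a b : A, 0 ≤ a → 0 ≤ b → 0 ≤ a * b)
    {a b c : A} (hab : a ≤ b) (hc : 0 ≤ c) : a * c ≤ b * c := by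
  rw [← sub_nonneg, ← sub_mul]
  exact hpos _ _ (sub_nonneg.2 hab) hc

omit [Module ℝ A] [PosSMulMono ℝ A] in
lemma abs_mul_le_mul_abs (hpos : ∀ a b : A, 0 ≤ a → 0 ≤ b → 0 ≤ a * b) (a b : A) :
    |a * b| ≤ |a| * |b| := by
  have h1 := hpos _ _ (posPart_nonneg a) (posPart_nonneg b)
  have h2 := hpos _ _ (posPart_nonneg a) (negPart_nonneg b)
  have h3 := hpos _ _ (negPart_nonneg a) (posPart_nonneg b)
  have h4 := hpos _ _ (negPart_nonneg a) (negPart_nonneg b)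
  have e : a * b = (a⁺ - a⁻) * (b⁺ - b⁻) := by simp only [posPart_sub_negPart]
  rw [← posPart_add_negPart a, ← posPart_add_negPart b, e]
  refine abs_le'.2 ⟨?_, ?_⟩ <;> rw [← sub_nonneg]
  · have : (a⁺ + a⁻) * (b⁺ + b⁻) - (a⁺ - a⁻) * (b⁺ - b⁻)
      = (a⁺ * b⁻ + a⁺ * b⁻) + (a⁻ * b⁺ + a⁻ * b⁺) := by noncomm_ring
    rw [this]
    exact add_nonneg (add_nonneg h2 h2) (add_nonneg h3 h3)
  · have : (a⁺ + a⁻) * (b⁺ + b⁻) - -((a⁺ - a⁻) * (b⁺ - b⁻))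
      = (a⁺ * b⁺ + a⁺ * b⁺) + (a⁻ * b⁻ + a⁻ * b⁻) := by noncomm_ring
    rw [this]
    exact add_nonneg (add_nonneg h1 h1) (add_nonneg h4 h4)

omit [Module ℝ A] [CovariantClass A A (· + ·) (· ≤ ·)] [PosSMulMono ℝ A] in
lemma mul_eq_zero_of_inf_eq_zero
    (hfalg : ∀ a b c : A, a ⊓ b = 0 → 0 ≤ c → (c * a) ⊓ b = 0 ∧ (a * c) ⊓ b = 0)
    {p q : A} (h : p ⊓ q = 0) : p * q = 0 := by
  have hp : 0 ≤ p := h ▸ inf_le_left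
  have hq : 0 ≤ q := h ▸ inf_le_right
  have h1 := (hfalg p q q h hq).2
  have h2 := (hfalg q (p * q) p (by rwa [inf_comm]) hp).1
  rwa [inf_idem] at h2

omit [Module ℝ A] [PosSMulMono ℝ A] in
lemma posPart_mul_negPart_eq_zero
    (hfalg : ∀ a b c : A, a ⊓ b = 0 → 0 ≤ c → (c * a) ⊓ b = 0 ∧ (a * c) ⊓ b = 0)
    (x : A) : x⁺ * x⁻ = 0 ∧ x⁻ * x⁺ = 0 :=
  ⟨mul_eq_zero_of_inf_eq_zero hfalg (posPart_inf_negPart_eq_zero x),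
    mul_eq_zero_of_inf_eq_zero hfalg (by rw [inf_comm, posPart_inf_negPart_eq_zero x])⟩

omit [Module ℝ A] [PosSMulMono ℝ A] in
lemma one_nonneg_of_falgebra (hpos : ∀ a b : A, 0 ≤ a → 0 ≤ b → 0 ≤ a * b)
    (hfalg : ∀ a b c : A, a ⊓ b = 0 → 0 ≤ c → (c * a) ⊓ b = 0 ∧ (a * c) ⊓ b = 0) :
    (0 : A) ≤ 1 := by
  have h : (1 : A)⁻ = -((1 : A)⁻ * (1 : A)⁻) := by
    have e : (1 : A)⁻ * ((1 : A)⁺ - (1 : A)⁻) = (1 : A)⁻ := by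
      rw [posPart_sub_negPart, mul_one]
    rw [mul_sub, (posPart_mul_negPart_eq_zero hfalg (1 : A)).2, zero_sub] at e
    exact e.symm
  have h0 := hpos _ _ (negPart_nonneg (1 : A)) (negPart_nonneg (1 : A))
  have h1 : (1 : A)⁻ ≤ 0 := h ▸ neg_nonpos.2 h0
  exact negPart_eq_zero.1 (le_antisymm h1 (negPart_nonneg _))

omit [Module ℝ A] [PosSMulMono ℝ A] in
/-- If `u ≥ 0` then `u (x - u)⁺ ≤ x (x - u)⁺`. -/
lemma mul_posPart_sub_le (hpos : ∀ a b : A, 0 ≤ a → 0 ≤ b → 0 ≤ a * b)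
    (hfalg : ∀ a b c : A, a ⊓ b = 0 → 0 ≤ c → (c * a) ⊓ b = 0 ∧ (a * c) ⊓ b = 0)
    {x u : A} (hx : 0 ≤ x) (hu : 0 ≤ u) : u * (x - u)⁺ ≤ x * x := by
  have h1 : u * (x - u)⁺ ≤ x * (x - u)⁺ := by
    rw [← sub_nonneg, ← sub_mul]
    nth_rewrite 1 [← posPart_sub_negPart (x - u)]
    rw [sub_mul, (posPart_mul_negPart_eq_zero hfalg (x - u)).2, sub_zero]
    exact hpos _ _ (posPart_nonneg _) (posPart_nonneg _)
  refine h1.trans (mul_le_mul_left_of_pos hpos ?_ hx)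
  exact sup_le (sub_le_self _ hu) hx

/-- A filter of the lattice `A` containing all `|x - t • 1|` contains arbitrarily small
multiples of `1 + x * x`. -/
lemma smul_mem_of_abs_sub_mem (hpos : ∀ a b : A, 0 ≤ a → 0 ≤ b → 0 ≤ a * b)
    (hfalg : ∀ a b c : A, a ⊓ b = 0 → 0 ≤ c → (c * a) ⊓ b = 0 ∧ (a * c) ⊓ b = 0)
    (harch : ∀ x y : A, (∀ n : ℕ, (n : ℝ) • x ≤ y) → x ≤ 0)
    {G : Set A} (hinf : ∀ a ∈ G, ∀ b ∈ G, a ⊓ b ∈ G) (hup : ∀ a ∈ G, ∀ b, a ≤ b → b ∈ G)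
    {x : A} (hx : 0 ≤ x) (hG : ∀ t : ℝ, |x - t • (1 : A)| ∈ G) (N : ℕ) :
    ((N : ℝ) + 1)⁻¹ • (1 + x * x) ∈ G := by
  have h1 := one_nonneg_of_falgebra hpos hfalg
  have hN : (0 : ℝ) < (N : ℝ) + 1 := by positivity
  set h : A := ((N : ℝ) + 1)⁻¹ • (1 : A) with hh
  have hh0 : 0 ≤ h := smul_nonneg (by positivity) h1
  have step : ∀ y : A, (h ⊔ y) ⊓ |y - h| ≤ h ⊔ (y - h) := by
    intro y
    let _ : DistribLattice A := AddCommGroup.toDistribLattice A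
    have h2 : y ⊓ (h - y) ≤ h := by
      have h3 : y ⊓ (h - y) + y ⊓ (h - y) ≤ h :=
        (add_le_add inf_le_left inf_le_right).trans_eq (add_sub_cancel y h)
      calc y ⊓ (h - y) = (2⁻¹ : ℝ) • (y ⊓ (h - y) + y ⊓ (h - y)) := by
            rw [← two_smul ℝ, smul_smul, inv_mul_cancel₀ two_ne_zero, one_smul]
        _ ≤ (2⁻¹ : ℝ) • h := smul_le_smul_of_nonneg_left h3 (by norm_num)
        _ ≤ (1 : ℝ) • h := smul_mono_scalar (by norm_num) hh0
        _ = h := one_smul _ _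
    have e : |y - h| = (y - h) ⊔ (h - y) := by rw [abs, neg_sub]
    rw [e]
    calc (h ⊔ y) ⊓ ((y - h) ⊔ (h - y))
        = h ⊓ ((y - h) ⊔ (h - y)) ⊔ (y ⊓ (y - h) ⊔ y ⊓ (h - y)) := by
          rw [inf_sup_right, inf_sup_left y]
      _ ≤ h ⊔ (y - h) := by
          refine sup_le (inf_le_left.trans le_sup_left) (sup_le ?_ ?_)
          · exact inf_le_right.trans le_sup_right
          · exact h2.trans le_sup_left
  have grid : ∀ k : ℕ, h ⊔ (x - (k : ℝ) • h) ∈ G := by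
    intro k
    induction k with
    | zero =>
      refine hup _ (hG 0) _ ?_
      simp [abs_of_nonneg hx]
    | succ k ih =>
      have e : x - ((k + 1 : ℕ) : ℝ) • h = x - (k : ℝ) • h - h := by
        push_cast
        rw [add_smul, one_smul, sub_add_eq_sub_sub]
      rw [e]
      refine hup _ (hinf _ ih _ (hG (((k + 1 : ℕ) : ℝ) * ((N : ℝ) + 1)⁻¹))) _ ?_
      rw [mul_smul, ← hh, e]
      exact step _
  refine hup _ (grid ((N + 1) * (N + 1))) _ ?_
  have e : (((N + 1) * (N + 1) : ℕ) : ℝ) • h = ((N : ℝ) + 1) • (1 : A) := by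
    rw [hh, smul_smul]
    congr 1
    push_cast
    field_simp
  rw [e]
  have hu : (0 : A) ≤ ((N : ℝ) + 1) • (1 : A) := smul_nonneg hN.le h1
  have hxx := hpos _ _ hx hx
  have hle : (x - ((N : ℝ) + 1) • (1 : A))⁺ ≤ ((N : ℝ) + 1)⁻¹ • (x * x) := by
    have := mul_posPart_sub_le hpos hfalg hx hu
    rw [real_smul_mul hpos harch, one_mul] at this
    have := smul_le_smul_of_nonneg_left this (inv_nonneg.2 hN.le)
    rwa [smul_smul, inv_mul_cancel₀ hN.ne', one_smul] at this
  rw [smul_add, ← hh]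
  refine sup_le (le_add_of_nonneg_right (smul_nonneg (by positivity) hxx)) ?_
  exact (le_posPart _).trans (hle.trans (le_add_of_nonneg_left hh0))

/-- A bounded operator on a unital Archimedean `f`-algebra is right multiplication by its
value at `1`. -/
lemma map_eq_mul_map_one (hpos : ∀ a b : A, 0 ≤ a → 0 ≤ b → 0 ≤ a * b)
    (hfalg : ∀ a b c : A, a ⊓ b = 0 → 0 ≤ c → (c * a) ⊓ b = 0 ∧ (a * c) ⊓ b = 0)
    (harch : ∀ x y : A, (∀ n : ℕ, (n : ℝ) • x ≤ y) → x ≤ 0)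
    (T : A →ₗ[ℝ] A) {c : ℝ} (hc : 0 ≤ c) (hT : ∀ x, |T x| ≤ c • |x|) (x : A) :
    T x = x * T 1 := by
  have h1 := one_nonneg_of_falgebra hpos hfalg
  have hpart : ∀ x : A, 0 ≤ x → T x = x * T 1 := by
    intro x hx
    have hmem := smul_mem_of_abs_sub_mem hpos hfalg harch
      (G := {a | |T x - x * T 1| ≤ (c + c) • a}) (x := x) ?_ ?_ hx ?_
    · have hle : |T x - x * T 1| ≤ 0 := by
        refine harch _ ((c + c) • (1 + x * x)) fun n => ?_
        have h := hmem n
        rw [Set.mem_ofPred_eq, smul_comm] at h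
        have h' := smul_le_smul_of_nonneg_left h (by positivity : (0 : ℝ) ≤ (n : ℝ) + 1)
        rw [smul_smul, mul_inv_cancel₀ (by positivity), one_smul] at h'
        exact (smul_mono_scalar (by linarith) (abs_nonneg _)).trans h'
      have h0 := le_antisymm hle (abs_nonneg _)
      have h2 := h0 ▸ le_abs_self (T x - x * T 1)
      have h3 := h0 ▸ neg_le_abs (T x - x * T 1)
      exact sub_eq_zero.1 (le_antisymm h2 (neg_nonpos.1 h3))
    · intro a ha b hb
      rcases eq_or_lt_of_le (add_nonneg hc hc) with h0 | h0
      · simp only [Set.mem_ofPred_eq, ← h0, zero_smul] at ha ⊢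
        exact ha
      · have key : ∀ a, |T x - x * T 1| ≤ (c + c) • a ↔
            (c + c)⁻¹ • |T x - x * T 1| ≤ a := fun a => by
          constructor <;> intro h
          · have := smul_le_smul_of_nonneg_left h (inv_nonneg.2 h0.le)
            rwa [smul_smul, inv_mul_cancel₀ h0.ne', one_smul] at this
          · have := smul_le_smul_of_nonneg_left h h0.le
            rwa [smul_smul, mul_inv_cancel₀ h0.ne', one_smul] at this
        rw [Set.mem_ofPred_eq, key] at ha hb ⊢
        exact le_inf ha hb
    · intro a ha b hab
      exact le_trans ha (smul_le_smul_of_nonneg_left hab (add_nonneg hc hc))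
    · intro t
      set b := x - t • (1 : A) with hb
      have e : T x - x * T 1 = T b + -(b * T 1) := by
        rw [hb, map_sub, map_smul, sub_mul, real_smul_mul hpos harch, one_mul]
        abel
      have hT1 : |T 1| ≤ c • (1 : A) := by simpa [abs_of_nonneg h1] using hT 1
      rw [Set.mem_ofPred_eq, e]
      calc |T b + -(b * T 1)| ≤ |T b| + |-(b * T 1)| := abs_add_le _ _
        _ ≤ c • |b| + c • |b| := by
          refine add_le_add (hT b) ?_
          rw [abs_neg]
          refine (abs_mul_le_mul_abs hpos _ _).trans ?_
          refine (mul_le_mul_left_of_pos hpos hT1 (abs_nonneg b)).trans ?_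
          rw [mul_real_smul hpos harch, mul_one]
        _ = (c + c) • |b| := (add_smul _ _ _).symm
  rw [← posPart_sub_negPart x, map_sub, sub_mul, ← hpart _ (posPart_nonneg x),
    ← hpart _ (negPart_nonneg x)]

lemma apply_le_apply_inf_mul (hpos : ∀ a b : A, 0 ≤ a → 0 ≤ b → 0 ≤ a * b)
    (hfalg : ∀ a b c : A, a ⊓ b = 0 → 0 ≤ c → (c * a) ⊓ b = 0 ∧ (a * c) ⊓ b = 0)
    (harch : ∀ x y : A, (∀ n : ℕ, (n : ℝ) • x ≤ y) → x ≤ 0)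
    {f : A →ₗ[ℝ] ℝ} (hf : ∀ z, 0 ≤ z → 0 ≤ f z) {w : A →+ ℝ} {a b : A}
    (ha : ∀ z, 0 ≤ z → w z ≤ f (a * z)) (hb : ∀ z, 0 ≤ z → w z ≤ f (b * z))
    {z : A} (hz : 0 ≤ z) : w z ≤ f ((a ⊓ b) * z) := by
  set p := a - a ⊓ b with hp
  set q := b - a ⊓ b with hq
  have hp0 : 0 ≤ p := sub_nonneg.2 inf_le_left
  have hq0 : 0 ≤ q := sub_nonneg.2 inf_le_right
  have hpq : p ⊓ q = 0 := by rw [hp, hq, ← inf_sub, sub_self]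
  have hpq' : p * q = 0 := mul_eq_zero_of_inf_eq_zero hfalg hpq
  have hmono : ∀ {u v : A}, u ≤ v → f u ≤ f v := fun {u v} h => by
    rw [← sub_nonneg, ← map_sub]
    exact hf _ (sub_nonneg.2 h)
  have key : ∀ n : ℕ, n * (w z - f ((a ⊓ b) * z)) ≤ f (z * z) := by
    intro n
    have hnq : 0 ≤ (n : ℝ) • q := smul_nonneg n.cast_nonneg hq0
    set v := (z - (n : ℝ) • q)⁺ with hv
    have hv0 : 0 ≤ v := posPart_nonneg _
    have hvz : v ≤ z := sup_le (sub_le_self _ hnq) hz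
    have hu0 : 0 ≤ z - v := sub_nonneg.2 hvz
    have hunq : z - v ≤ (n : ℝ) • q := sub_le_comm.1 (le_posPart _)
    have h1 : f (p * (z - v)) ≤ 0 := by
      have h := hmono (mul_le_mul_left_of_pos hpos hunq hp0)
      rwa [mul_real_smul hpos harch, hpq', smul_zero, map_zero] at h
    have h2 : n * f (q * v) ≤ f (z * z) := by
      have h := hmono (mul_posPart_sub_le hpos hfalg hz hnq)
      rwa [real_smul_mul hpos harch, map_smul, smul_eq_mul] at h
    have h3 := ha _ hu0
    have h4 := hb _ hv0
    have ea : a = a ⊓ b + p := (add_sub_cancel _ _).symm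
    have eb : b = a ⊓ b + q := (add_sub_cancel _ _).symm
    have e3 : a * (z - v) = (a ⊓ b) * (z - v) + p * (z - v) := by rw [← add_mul, ← ea]
    have e4 : b * v = (a ⊓ b) * v + q * v := by rw [← add_mul, ← eb]
    rw [e3, map_add] at h3
    rw [e4, map_add] at h4
    rw [mul_sub (a ⊓ b), map_sub, map_sub] at h3
    have h5 : w z - f ((a ⊓ b) * z) ≤ f (q * v) := by linarith
    exact (mul_le_mul_of_nonneg_left h5 n.cast_nonneg).trans h2
  by_contra hcon
  push Not at hcon
  obtain ⟨n, hn⟩ := exists_nat_gt (f (z * z) / (w z - f ((a ⊓ b) * z)))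
  rw [div_lt_iff₀ (sub_pos.2 hcon)] at hn
  exact absurd (key n) (not_le.2 hn)

end UnitalFAlgebra

section OrderDual

variable {A DA : Type*} [Lattice A] [Ring A] [Module ℝ A]
  [CovariantClass A A (· + ·) (· ≤ ·)] [PosSMulMono ℝ A]
  [Lattice DA] [AddCommGroup DA] [Module ℝ DA] {pA : DA → A → ℝ}

omit [CovariantClass A A (· + ·) (· ≤ ·)] [PosSMulMono ℝ A] in
lemma IsOrderDual.nonneg_iff (hDA : IsOrderDual A DA pA) (f : DA) :
    0 ≤ f ↔ ∀ x : A, 0 ≤ x → 0 ≤ pA f x := by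
  have h0 : ∀ x, pA 0 x = 0 := fun x => (hDA.lin_vec x).map_zero
  simp only [hDA.le_iff, h0]

/-- The functional `y ↦ f (x * y)`. -/
lemma IsOrderDual.exists_mul (hDA : IsOrderDual A DA pA)
    (hpos : ∀ a b : A, 0 ≤ a → 0 ≤ b → 0 ≤ a * b)
    (harch : ∀ x y : A, (∀ n : ℕ, (n : ℝ) • x ≤ y) → x ≤ 0) (f : DA) (x : A) :
    ∃ g : DA, ∀ y, pA g y = pA f (x * y) := by
  refine hDA.surj (fun y => pA f (x * y)) ⟨fun u v => ?_, fun r u => ?_⟩ fun a b => ?_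
  · rw [mul_add, (hDA.lin_fun f).map_add]
  · rw [mul_real_smul hpos harch, (hDA.lin_fun f).map_smul]
  · obtain ⟨l, u, h⟩ := hDA.bdd f (-(|x| * (|a| + |b|))) (|x| * (|a| + |b|))
    refine ⟨l, u, fun y hay hyb => ?_⟩
    have hy : |y| ≤ |a| + |b| := abs_le'.2
      ⟨hyb.trans ((le_abs_self b).trans (le_add_of_nonneg_left (abs_nonneg a))),
        (neg_le_neg_iff.2 hay).trans
          ((neg_le_abs a).trans (le_add_of_nonneg_right (abs_nonneg b)))⟩
    have hxy := (abs_mul_le_mul_abs hpos x y).trans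
      (mul_le_mul_left_of_pos hpos hy (abs_nonneg x))
    exact h _ (neg_le.1 ((neg_le_abs _).trans hxy)) ((le_abs_self _).trans hxy)

lemma apply_central_mul_le (hDA : IsOrderDual A DA pA)
    (hpos : ∀ a b : A, 0 ≤ a → 0 ≤ b → 0 ≤ a * b)
    (hfalg : ∀ a b c : A, a ⊓ b = 0 → 0 ≤ c → (c * a) ⊓ b = 0 ∧ (a * c) ⊓ b = 0)
    (harch : ∀ x y : A, (∀ n : ℕ, (n : ℝ) • x ≤ y) → x ≤ 0)
    (S : DA →ₗ[ℝ] DA) {c : ℝ} (hc : 0 ≤ c)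
    (hS : ∀ f x, 0 ≤ f → 0 ≤ x → |pA (S f) x| ≤ c * pA f x)
    {f : DA} (hf : 0 ≤ f) {x : A} (hx : 0 ≤ x) {g : DA} (hg : ∀ y, pA g y = pA f (x * y))
    {z : A} (hz : 0 ≤ z) : pA (S g) z ≤ pA (S f) (x * z) := by
  choose d hd using fun a => hDA.exists_mul hpos harch f a
  have hf' := (hDA.nonneg_iff f).1 hf
  have hd0 : ∀ a, 0 ≤ a → 0 ≤ d a := fun a ha =>
    (hDA.nonneg_iff _).2 fun y hy => by
      rw [hd]
      exact hf' _ (hpos _ _ ha hy)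
  let w : A →+ ℝ := AddMonoidHom.mk' (fun z => pA (S g) z - pA (S f) (x * z)) fun u v => by
    rw [mul_add, (hDA.lin_fun _).map_add, (hDA.lin_fun _).map_add]
    ring
  let F : A →ₗ[ℝ] ℝ := (c + c) • (hDA.lin_fun f).mk'
  have hF : ∀ z, F z = (c + c) * pA f z := fun _ => rfl
  have hw : ∀ z, w z = pA (S g) z - pA (S f) (x * z) := fun _ => rfl
  have hF0 : ∀ z, 0 ≤ z → 0 ≤ F z := fun z hz =>
    mul_nonneg (add_nonneg hc hc) (hf' z hz)
  have hmem := smul_mem_of_abs_sub_mem hpos hfalg harch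
      (G := {a | ∀ z, 0 ≤ z → w z ≤ F (a * z)}) (x := x) ?_ ?_ hx ?_
  · rw [← sub_nonpos, ← hw]
    by_contra hcon
    push Not at hcon
    obtain ⟨n, hn⟩ := exists_nat_gt (F ((1 + x * x) * z) / w z)
    rw [div_lt_iff₀ hcon] at hn
    have h := hmem n z hz
    rw [real_smul_mul hpos harch, map_smul, smul_eq_mul, inv_mul_eq_div,
      le_div_iff₀ (by positivity)] at h
    linarith
  · exact fun a ha b hb z hz => apply_le_apply_inf_mul hpos hfalg harch hF0 ha hb hz
  · intro a ha b hab z hz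
    refine (ha z hz).trans ?_
    rw [← sub_nonneg, ← map_sub]
    exact hF0 _ (sub_nonneg.2 (mul_le_mul_right_of_pos hpos hab hz))
  · intro t z hz
    set b := x - t • (1 : A) with hb
    have ex : x = b⁺ - b⁻ + t • 1 := by rw [posPart_sub_negPart, hb, sub_add_cancel]
    have eg : g = d b⁺ - d b⁻ + t • f := by
      refine hDA.inj _ _ fun y => ?_
      rw [(hDA.lin_vec y).map_add, (hDA.lin_vec y).map_sub, (hDA.lin_vec y).map_smul,
        hd, hd, hg]
      nth_rewrite 1 [ex]
      rw [add_mul, sub_mul, (hDA.lin_fun f).map_add, (hDA.lin_fun f).map_sub,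
        real_smul_mul hpos harch, one_mul, (hDA.lin_fun f).map_smul]
    have e1 : pA (S g) z = pA (S (d b⁺)) z - pA (S (d b⁻)) z + t * pA (S f) z := by
      rw [eg, map_add, map_sub, map_smul, (hDA.lin_vec z).map_add, (hDA.lin_vec z).map_sub,
        (hDA.lin_vec z).map_smul, smul_eq_mul]
    have e2 : pA (S f) (x * z)
        = pA (S f) (b⁺ * z) - pA (S f) (b⁻ * z) + t * pA (S f) z := by
      nth_rewrite 1 [ex]
      rw [add_mul, sub_mul, (hDA.lin_fun _).map_add, (hDA.lin_fun _).map_sub,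
        real_smul_mul hpos harch, one_mul, (hDA.lin_fun _).map_smul, smul_eq_mul]
    have e3 : F (|b| * z) = (c + c) * (pA f (b⁺ * z) + pA f (b⁻ * z)) := by
      rw [hF, ← posPart_add_negPart, add_mul b⁺, (hDA.lin_fun _).map_add]
    have h1 := abs_le.1 (hS (d b⁺) z (hd0 _ (posPart_nonneg b)) hz)
    have h2 := abs_le.1 (hS (d b⁻) z (hd0 _ (negPart_nonneg b)) hz)
    have h3 := abs_le.1 (hS f (b⁺ * z) hf (hpos _ _ (posPart_nonneg b) hz))
    have h4 := abs_le.1 (hS f (b⁻ * z) hf (hpos _ _ (negPart_nonneg b) hz))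
    rw [hd] at h1 h2
    rw [hw, e1, e2, e3]
    linarith [h1.2, h2.1, h3.1, h4.2]

/-- Central operators on the order dual commute with the adjoints of multiplications. -/
lemma apply_central_mul [CovariantClass DA DA (· + ·) (· ≤ ·)]
    (hDA : IsOrderDual A DA pA)
    (hpos : ∀ a b : A, 0 ≤ a → 0 ≤ b → 0 ≤ a * b)
    (hfalg : ∀ a b c : A, a ⊓ b = 0 → 0 ≤ c → (c * a) ⊓ b = 0 ∧ (a * c) ⊓ b = 0)
    (harch : ∀ x y : A, (∀ n : ℕ, (n : ℝ) • x ≤ y) → x ≤ 0)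
    (S : DA →ₗ[ℝ] DA) {c : ℝ} (hc : 0 ≤ c)
    (hS : ∀ f x, 0 ≤ f → 0 ≤ x → |pA (S f) x| ≤ c * pA f x)
    {f : DA} {x : A} {g : DA} (hg : ∀ y, pA g y = pA f (x * y))
    {z : A} (hz : 0 ≤ z) : pA (S g) z = pA (S f) (x * z) := by
  have hneg : ∀ g z, pA ((-S) g) z = -pA (S g) z := fun g z => by
    rw [LinearMap.neg_apply, (hDA.lin_vec z).map_neg]
  have h1 : ∀ f x, 0 ≤ f → 0 ≤ x → ∀ g, (∀ y, pA g y = pA f (x * y)) →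
      pA (S g) z = pA (S f) (x * z) := by
    intro f x hf hx g hg
    refine le_antisymm (apply_central_mul_le hDA hpos hfalg harch S hc hS hf hx hg hz) ?_
    have h := apply_central_mul_le hDA hpos hfalg harch (-S) hc
      (fun f x hf hx => by rw [hneg, abs_neg]; exact hS f x hf hx) hf hx hg hz
    rw [hneg, hneg] at h
    exact neg_le_neg_iff.1 h
  have h2 : ∀ f, 0 ≤ f → ∀ g, (∀ y, pA g y = pA f (x * y)) →
      pA (S g) z = pA (S f) (x * z) := by
    intro f hf g hg
    obtain ⟨u, hu⟩ := hDA.exists_mul hpos harch f x⁺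
    obtain ⟨v, hv⟩ := hDA.exists_mul hpos harch f x⁻
    have eg : g = u - v := hDA.inj _ _ fun y => by
      rw [(hDA.lin_vec y).map_sub, hu, hv, hg, ← (hDA.lin_fun f).map_sub, ← sub_mul,
        posPart_sub_negPart]
    rw [eg, map_sub, (hDA.lin_vec z).map_sub, h1 f _ hf (posPart_nonneg x) u hu,
      h1 f _ hf (negPart_nonneg x) v hv, ← (hDA.lin_fun _).map_sub, ← sub_mul,
      posPart_sub_negPart]
  obtain ⟨u, hu⟩ := hDA.exists_mul hpos harch f⁺ x
  obtain ⟨v, hv⟩ := hDA.exists_mul hpos harch f⁻ x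
  have eg : g = u - v := hDA.inj _ _ fun y => by
    rw [(hDA.lin_vec y).map_sub, hu, hv, hg, ← (hDA.lin_vec _).map_sub,
      posPart_sub_negPart]
  rw [eg, map_sub, (hDA.lin_vec z).map_sub, h2 _ (posPart_nonneg f) u hu,
    h2 _ (negPart_nonneg f) v hv, ← (hDA.lin_vec _).map_sub, ← map_sub,
    posPart_sub_negPart]

/-- A member of the order dual dominating `±g` whose value at `1` is bounded by
the supremum of `g` over `[-1, 1]`. -/
lemma IsOrderDual.exists_abs_le (hDA : IsOrderDual A DA pA)
    (h1 : (0 : A) ≤ 1) (g : DA)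
    {K : ℝ} (hK : ∀ y : A, |y| ≤ 1 → pA g y ≤ K) :
    ∃ h : DA, (∀ x, 0 ≤ x → |pA g x| ≤ pA h x) ∧ pA h 1 ≤ K := by
  have hg := hDA.lin_fun g
  let q : A → ℝ := fun x => sSup (pA g '' {y | |y| ≤ x})
  have hbdd : ∀ x, BddAbove (pA g '' {y | |y| ≤ x}) := fun x => by
    obtain ⟨l, u, h⟩ := hDA.bdd g (-x) x
    refine ⟨u, ?_⟩
    rintro _ ⟨y, hy, rfl⟩
    exact (h y (neg_le.1 ((neg_le_abs y).trans hy)) ((le_abs_self y).trans hy)).2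
  have le_q : ∀ {x y}, |y| ≤ x → pA g y ≤ q x := fun {x y} hy =>
    le_csSup (hbdd x) ⟨y, hy, rfl⟩
  have q_le : ∀ {x B}, 0 ≤ x → (∀ y, |y| ≤ x → pA g y ≤ B) → q x ≤ B := by
    intro x B hx h
    refine csSup_le ⟨_, 0, by simpa using hx, rfl⟩ ?_
    rintro _ ⟨y, hy, rfl⟩
    exact h y hy
  have q_add : ∀ {a b}, 0 ≤ a → 0 ≤ b → q (a + b) = q a + q b := by
    intro a b ha hb
    refine le_antisymm (q_le (add_nonneg ha hb) fun y hy => ?_) ?_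
    · obtain ⟨hy1, hy2⟩ := abs_le'.1 hy
      set u := (y ⊓ a) ⊔ -a with hu
      have hua : |u| ≤ a := abs_le'.2
        ⟨sup_le inf_le_right (neg_le_self ha), neg_le.1 le_sup_right⟩
      have hvb : |y - u| ≤ b := by
        refine abs_le'.2 ⟨?_, ?_⟩
        · have h : y - b ≤ u := by
            refine le_trans (le_inf (sub_le_self _ hb) ?_) le_sup_left
            rwa [sub_le_iff_le_add]
          exact sub_le_comm.1 h
        · rw [neg_sub, sub_le_iff_le_add]
          refine sup_le (inf_le_left.trans (le_add_of_nonneg_left hb)) ?_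
          rw [neg_le_iff_add_nonneg]
          have := neg_le_iff_add_nonneg.1 hy2
          calc (0 : A) ≤ a + b + y := this
            _ = b + y + a := by abel
      calc pA g y = pA g u + pA g (y - u) := by rw [← hg.map_add, add_sub_cancel]
        _ ≤ q a + q b := add_le_add (le_q hua) (le_q hvb)
    · rw [← le_sub_iff_add_le]
      refine q_le ha fun u hu => ?_
      rw [le_sub_iff_add_le, ← le_sub_iff_add_le']
      refine q_le hb fun v hv => ?_
      rw [le_sub_iff_add_le', ← hg.map_add]
      exact le_q ((abs_add_le u v).trans (add_le_add hu hv))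
  have q_zero : q 0 = 0 := by simpa using q_add le_rfl (le_refl (0 : A))
  have q_nonneg : ∀ {x}, 0 ≤ x → 0 ≤ q x := fun {x} hx => by
    have h := le_q (x := x) (y := 0) (by simpa using hx)
    rwa [hg.map_zero] at h
  let φ : A →+ ℝ := AddMonoidHom.mk' (fun x => q x⁺ - q x⁻) fun x y => by
    have e : (x + y)⁺ + (x⁻ + y⁻) = (x + y)⁻ + (x⁺ + y⁺) := by
      rw [← sub_eq_zero]
      calc (x + y)⁺ + (x⁻ + y⁻) - ((x + y)⁻ + (x⁺ + y⁺))
          = ((x + y)⁺ - (x + y)⁻) - (x⁺ - x⁻) - (y⁺ - y⁻) := by abel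
        _ = 0 := by
          simp only [posPart_sub_negPart]
          abel
    have e' := congrArg q e
    rw [q_add (posPart_nonneg _) (add_nonneg (negPart_nonneg _) (negPart_nonneg _)),
      q_add (negPart_nonneg _) (add_nonneg (posPart_nonneg _) (posPart_nonneg _)),
      q_add (posPart_nonneg _) (posPart_nonneg _),
      q_add (negPart_nonneg _) (negPart_nonneg _)] at e'
    linarith
  have hφ : ∀ {x}, 0 ≤ x → φ x = q x := fun {x} hx => by
    change q x⁺ - q x⁻ = q x
    rw [posPart_eq_self.2 hx, negPart_eq_zero.2 hx, q_zero, sub_zero]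
  have hφ0 : ∀ x, 0 ≤ x → 0 ≤ φ x := fun x hx => by
    rw [hφ hx]
    exact q_nonneg hx
  have hmono : ∀ {x y}, x ≤ y → φ x ≤ φ y := fun {x y} h => by
    rw [← sub_nonneg, ← map_sub]
    exact hφ0 _ (sub_nonneg.2 h)
  have harchR : ∀ x y : ℝ, (∀ n : ℕ, (n : ℝ) • x ≤ y) → x ≤ 0 := fun x y h => by
    by_contra hcon
    push Not at hcon
    obtain ⟨n, hn⟩ := exists_nat_gt (y / x)
    rw [div_lt_iff₀ hcon] at hn
    exact absurd (h n) (not_le.2 hn)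
  obtain ⟨h, hh⟩ := hDA.surj φ ⟨φ.map_add, map_real_smul_of_positive harchR hφ0⟩
    fun a b => ⟨φ a, φ b, fun x ha hb => ⟨hmono ha, hmono hb⟩⟩
  refine ⟨h, fun x hx => ?_, ?_⟩
  · rw [hh, hφ hx]
    refine abs_le'.2 ⟨le_q (abs_of_nonneg hx).le, ?_⟩
    rw [← hg.map_neg]
    exact le_q (by rw [abs_neg, abs_of_nonneg hx])
  · rw [hh, hφ h1]
    exact q_le h1 hK

/-- Left multiplication by `y` with `|y| ≤ 1` belongs to the ideal center. -/
lemma isCentral_mulLeft (hpos : ∀ a b : A, 0 ≤ a → 0 ≤ b → 0 ≤ a * b)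
    (hfalg : ∀ a b c : A, a ⊓ b = 0 → 0 ≤ c → (c * a) ⊓ b = 0 ∧ (a * c) ⊓ b = 0)
    (harch : ∀ x y : A, (∀ n : ℕ, (n : ℝ) • x ≤ y) → x ≤ 0)
    {y : A} (hy : |y| ≤ 1) :
    IsCentral (fun z => y * z) ∧ ∀ x, 0 ≤ x → -((1 : ℝ) • x) ≤ y * x ∧ y * x ≤ (1 : ℝ) • x := by
  have habs : ∀ z, |y * z| ≤ (1 : ℝ) • |z| := fun z => by
    have h := mul_le_mul_right_of_pos hpos hy (abs_nonneg z)
    rw [one_mul] at h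
    rw [one_smul]
    exact (abs_mul_le_mul_abs hpos y z).trans h
  have hb : ∀ x, 0 ≤ x → -((1 : ℝ) • x) ≤ y * x ∧ y * x ≤ (1 : ℝ) • x := fun x hx => by
    have h := habs x
    rw [abs_of_nonneg hx] at h
    exact ⟨neg_le.1 ((neg_le_abs _).trans h), (le_abs_self _).trans h⟩
  refine ⟨⟨⟨⟨fun u v => mul_add y u v, fun r u => mul_real_smul hpos harch r y u⟩,
    isOrdBdd_of_abs_le (AddMonoidHom.mulLeft y) zero_le_one habs, fun x z hxz => ?_⟩,
    1, hb⟩, hb⟩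
  refine le_antisymm ?_ (le_inf (abs_nonneg _) (abs_nonneg _))
  rw [← (hfalg _ _ |y| hxz (abs_nonneg y)).1]
  exact inf_le_inf_right _ (abs_mul_le_mul_abs hpos y x)

end OrderDual

/-- Factoring a functional through a linear map that dominates it in norm, and extending it
continuously. -/
lemma exists_continuousLinearMap_comp_eq {V W : Type*} [AddCommGroup V] [Module ℝ V]
    [NormedAddCommGroup W] [NormedSpace ℝ W] (L : V →ₗ[ℝ] W) (ψ : V →ₗ[ℝ] ℝ) (c : ℝ)
    (h : ∀ v, |ψ v| ≤ c * ‖L v‖) : ∃ F : W →L[ℝ] ℝ, ∀ v, F (L v) = ψ v := by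
  have hker : L.ker ≤ ψ.ker := fun v hv => by
    have := h v
    rw [LinearMap.mem_ker.1 hv, norm_zero, mul_zero] at this
    exact abs_nonpos_iff.1 this
  let Φ : L.range →ₗ[ℝ] ℝ :=
    (L.ker.liftQ ψ hker) ∘ₗ (L.quotKerEquivRange.symm : L.range →ₗ[ℝ] V ⧸ L.ker)
  have hΦ : ∀ v, Φ ⟨L v, v, rfl⟩ = ψ v := fun v => by
    have e : L.quotKerEquivRange.symm ⟨L v, v, rfl⟩ = L.ker.mkQ v := by
      rw [LinearEquiv.symm_apply_eq]
      rfl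
    change L.ker.liftQ ψ hker (L.quotKerEquivRange.symm ⟨L v, v, rfl⟩) = ψ v
    rw [e]
    simp
  let Φc : L.range →L[ℝ] ℝ := Φ.mkContinuous c (by
    rintro ⟨_, v, rfl⟩
    rw [hΦ, Real.norm_eq_abs]
    exact h v)
  obtain ⟨F, hF, -⟩ := exists_extension_norm_eq (𝕜 := ℝ) L.range Φc
  exact ⟨F, fun v => (hF ⟨L v, v, rfl⟩).trans (hΦ v)⟩

/-- Proposition 4.  Let `A` be a unital Archimedean `f`-algebra with
point separating order dual `A^∼` (realized as `DA`), and let `Z` realize the ideal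
center `Z(A)`.  Then the Arens homomorphism `m : Z(A)'' → Z(A^∼)` is surjective onto the
ideal center of `A^∼`. -/
theorem statement3
    {A DA Z : Type*}
    [Lattice A] [Ring A] [Module ℝ A]
    [CovariantClass A A (· + ·) (· ≤ ·)] [PosSMulMono ℝ A]
    [Lattice DA] [AddCommGroup DA] [Module ℝ DA]
    [CovariantClass DA DA (· + ·) (· ≤ ·)] [PosSMulMono ℝ DA]
    [Lattice Z] [NormedRing Z] [NormedAlgebra ℝ Z]
    [CovariantClass Z Z (· + ·) (· ≤ ·)] [PosSMulMono ℝ Z]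
    -- `A` is a (unital) `f`-algebra:
    (hpos : ∀ a b : A, 0 ≤ a → 0 ≤ b → 0 ≤ a * b)
    (hfalg : ∀ a b c : A, a ⊓ b = 0 → 0 ≤ c → (c * a) ⊓ b = 0 ∧ (a * c) ⊓ b = 0)
    -- `A` is Archimedean:
    (harch : ∀ x y : A, (∀ n : ℕ, (n : ℝ) • x ≤ y) → x ≤ 0)
    (pA : DA → A → ℝ) (hDA : IsOrderDual A DA pA) (hsep : SepPoints pA)
    (ρ : Z → A → A) (hZ : IsCenterOf A Z ρ)
    (m : ((Z →L[ℝ] ℝ) →L[ℝ] ℝ) → DA → DA)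
    (hm : ∀ (F : (Z →L[ℝ] ℝ) →L[ℝ] ℝ) (f : DA) (x : A) (μ : Z →L[ℝ] ℝ),
      (∀ T : Z, μ T = pA f (ρ T x)) → pA (m F f) x = F μ) :
    -- `m` is onto `Z(A^∼)`:
    ∀ S : DA → DA, IsCentral S → ∃ F : (Z →L[ℝ] ℝ) →L[ℝ] ℝ, ∀ f : DA, m F f = S f := by
  rintro S ⟨⟨hSlin, -, -⟩, c₀, hc₀⟩
  have h1 := one_nonneg_of_falgebra hpos hfalg
  have hS : ∀ (f : DA) (x : A), 0 ≤ f → 0 ≤ x →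
      |pA (IsLinearMap.mk' _ hSlin f) x| ≤ |c₀| * pA f x := by
    intro f x hf hx
    have hfx := (hDA.nonneg_iff f).1 hf x hx
    have hl := (hDA.le_iff _ _).1 (hc₀ f hf).1 x hx
    have hu := (hDA.le_iff _ _).1 (hc₀ f hf).2 x hx
    rw [(hDA.lin_vec x).map_neg, (hDA.lin_vec x).map_smul, smul_eq_mul] at hl
    rw [(hDA.lin_vec x).map_smul, smul_eq_mul] at hu
    have hc := mul_le_mul_of_nonneg_right (le_abs_self c₀) hfx
    exact abs_le.2 ⟨(neg_le_neg hc).trans hl, hu.trans hc⟩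
  have hρ : ∀ (T : Z) (x : A), |ρ T x| ≤ ‖T‖ • |x| := fun T x =>
    abs_map_le_smul_abs (IsLinearMap.mk' _ (hZ.central T).1.1).toAddMonoidHom
      ((hZ.norm_le_iff T ‖T‖ (norm_nonneg T)).1 le_rfl) x
  have hpos_bound : ∀ (f : DA), 0 ≤ f → ∀ T : Z, |pA f (ρ T 1)| ≤ ‖T‖ * pA f 1 := by
    intro f hf T
    have h := hρ T 1
    rw [abs_of_nonneg h1] at h
    have hmono : ∀ {u v}, u ≤ v → pA f u ≤ pA f v := fun {u v} huv => by
      rw [← sub_nonneg, ← (hDA.lin_fun f).map_sub]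
      exact (hDA.nonneg_iff f).1 hf _ (sub_nonneg.2 huv)
    have e : pA f (‖T‖ • (1 : A)) = ‖T‖ * pA f 1 := (hDA.lin_fun f).map_smul _ _
    rw [← e]
    refine abs_le'.2 ⟨hmono ((le_abs_self _).trans h), ?_⟩
    rw [← (hDA.lin_fun f).map_neg]
    exact hmono ((neg_le_abs _).trans h)
  have hbound : ∀ (f : DA) (T : Z), |pA f (ρ T 1)| ≤ (pA f⁺ 1 + pA f⁻ 1) * ‖T‖ := by
    intro f T
    have e : pA f (ρ T 1) = pA f⁺ (ρ T 1) - pA f⁻ (ρ T 1) := by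
      rw [← (hDA.lin_vec _).map_sub, posPart_sub_negPart]
    rw [e]
    have h2 := hpos_bound _ (posPart_nonneg f) T
    have h3 := hpos_bound _ (negPart_nonneg f) T
    linarith [abs_sub (pA f⁺ (ρ T 1)) (pA f⁻ (ρ T 1))]
  let L : DA →ₗ[ℝ] (Z →L[ℝ] ℝ) :=
    { toFun := fun f =>
        (IsLinearMap.mk' _ (hDA.lin_fun f) ∘ₗ IsLinearMap.mk' _ (hZ.lin_vec 1)).mkContinuous _
          (hbound f)
      map_add' := fun f g => ContinuousLinearMap.ext fun T => (hDA.lin_vec _).map_add f g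
      map_smul' := fun r f => ContinuousLinearMap.ext fun T => (hDA.lin_vec _).map_smul r f }
  have hL : ∀ f T, L f T = pA f (ρ T 1) := fun _ _ => rfl
  obtain ⟨F, hF⟩ := exists_continuousLinearMap_comp_eq L
    (IsLinearMap.mk' _ (hDA.lin_vec 1) ∘ₗ IsLinearMap.mk' _ hSlin) |c₀| (fun g => by
      obtain ⟨h, hgh, hh⟩ := hDA.exists_abs_le h1 g (K := ‖L g‖) fun y hy => by
        obtain ⟨hcen, hb⟩ := isCentral_mulLeft hpos hfalg harch hy
        obtain ⟨T, hT⟩ := hZ.surj _ hcen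
        have hT1 : ‖T‖ ≤ 1 := (hZ.norm_le_iff T 1 zero_le_one).2 fun x hx => by
          rw [hT]
          exact hb x hx
        have e : pA g y = L g T := by rw [hL, hT, mul_one]
        rw [e]
        exact (le_abs_self _).trans ((L g).le_of_opNorm_le_of_le le_rfl hT1 |>.trans_eq
          (mul_one _))
      have hsub : 0 ≤ h - g := (hDA.nonneg_iff _).2 fun x hx => by
        rw [(hDA.lin_vec x).map_sub]
        linarith [(abs_le.1 (hgh x hx)).2]
      have hadd : 0 ≤ h + g := (hDA.nonneg_iff _).2 fun x hx => by
        rw [(hDA.lin_vec x).map_add]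
        linarith [(abs_le.1 (hgh x hx)).1]
      have ha := abs_le.1 (hS _ 1 hadd h1)
      have hs := abs_le.1 (hS _ 1 hsub h1)
      rw [map_add, (hDA.lin_vec 1).map_add, (hDA.lin_vec 1).map_add] at ha
      rw [map_sub, (hDA.lin_vec 1).map_sub, (hDA.lin_vec 1).map_sub] at hs
      have hK := mul_le_mul_of_nonneg_left hh (abs_nonneg c₀)
      change |pA (IsLinearMap.mk' _ hSlin g) 1| ≤ _
      exact abs_le.2 ⟨by linarith [ha.1, hs.2], by linarith [ha.2, hs.1]⟩)
  refine ⟨F, fun f => hDA.inj _ _ fun x => ?_⟩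
  obtain ⟨g, hg⟩ := hDA.exists_mul hpos harch f x
  rw [hm F f x (L g) fun T => ?_, hF]
  · change pA (IsLinearMap.mk' _ hSlin g) 1 = pA (S f) x
    rw [apply_central_mul hDA hpos hfalg harch (IsLinearMap.mk' _ hSlin) (abs_nonneg c₀) hS hg h1,
      mul_one]
    rfl
  · have hTx : ρ T x = x * ρ T 1 :=
      map_eq_mul_map_one hpos hfalg harch (IsLinearMap.mk' _ (hZ.central T).1.1) (norm_nonneg T)
        (hρ T) x
    rw [hL, hg, ← hTx]
end

section
/- Let E be a Riesz space with point separating order dual, let A = Orth(E) (so that Z(A)=Z(E)), and let m_A : Z(A)'' → Z(A^~) be the Arens homomorphism of the bidual of Z(A). Then the diagram commutes: for every F ∈ Z(E)'' = Z(A)'', one has γ(m_A(F)) = m(F), where γ : (A^~)_n^~ → Orth(E^~) is the Arens homomorphism of the order bidual of Orth(E), Z(A^~) is regarded as a subset of (A^~)_n^~ via the natural inclusion, and m : Z(E)'' → Z(E^~) is the Arens homomorphism of the bidual of Z(E). -/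
/-- Every element of a Riesz space is a difference of positive elements. -/
theorem exists_nonneg_sub_eq {E : Type*} [Lattice E] [AddCommGroup E]
    [CovariantClass E E (· + ·) (· ≤ ·)] (x : E) : ∃ u v : E, 0 ≤ u ∧ 0 ≤ v ∧ x = u - v :=
  haveI : AddLeftMono E := ‹_›
  ⟨x⁺, x⁻, posPart_nonneg x, negPart_nonneg x, (posPart_sub_negPart x).symm⟩

/-- For `x ∈ E` and `f ∈ E^∼`, the functional `ψ_{x,f} : π ↦ f(πx)` on `Orth(E)` belongs to
the order dual of `Orth(E)`. -/
theorem IsOrthAlg.exists_dual_apply {E D O DO : Type*}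
    [Lattice E] [AddCommGroup E] [Module ℝ E] [CovariantClass E E (· + ·) (· ≤ ·)]
    [Lattice D] [AddCommGroup D] [Module ℝ D]
    [Lattice O] [Ring O] [Module ℝ O] [Lattice DO] [AddCommGroup DO] [Module ℝ DO]
    {pE : D → E → ℝ} (hD : IsOrderDual E D pE) {ρ : O → E → E} (hO : IsOrthAlg E O ρ)
    {pO : DO → O → ℝ} (hDO : IsOrderDual O DO pO) (f : D) (x : E) :
    ∃ ψ : DO, ∀ π : O, pO ψ π = pE f (ρ π x) := by
  refine hDO.surj (fun π => pE f (ρ π x)) ⟨fun a b => ?_, fun c a => ?_⟩ fun a b => ?_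
  · rw [(hO.lin_vec x).map_add, (hD.lin_fun f).map_add]
  · rw [(hO.lin_vec x).map_smul, (hD.lin_fun f).map_smul]
  · obtain ⟨u, v, hu, hv, rfl⟩ := exists_nonneg_sub_eq x
    obtain ⟨c, d, hcd⟩ := hD.bdd f (ρ a u) (ρ b u)
    obtain ⟨c', d', hcd'⟩ := hD.bdd f (ρ a v) (ρ b v)
    refine ⟨c - d', d - c', fun π ha hb => ?_⟩
    have h := hcd (ρ π u) ((hO.le_iff _ _).1 ha u hu) ((hO.le_iff _ _).1 hb u hu)
    have h' := hcd' (ρ π v) ((hO.le_iff _ _).1 ha v hv) ((hO.le_iff _ _).1 hb v hv)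
    beta_reduce
    rw [(hO.ortho π).1.map_sub, (hD.lin_fun f).map_sub]
    constructor <;> linarith

/-- For `x ∈ E` and `f ∈ E^∼`, the functional `μ_{x,f} : T ↦ f(Tx)` on `Z(E)` belongs to
the norm dual of `Z(E)`. -/
theorem IsCenterOf.exists_dual_apply {E D Z : Type*}
    [Lattice E] [AddCommGroup E] [Module ℝ E] [CovariantClass E E (· + ·) (· ≤ ·)]
    [Lattice D] [AddCommGroup D] [Module ℝ D]
    [Lattice Z] [NormedRing Z] [NormedAlgebra ℝ Z]
    {pE : D → E → ℝ} (hD : IsOrderDual E D pE) {ρ : Z → E → E} (hZ : IsCenterOf E Z ρ)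
    (f : D) (x : E) :
    ∃ μ : Z →L[ℝ] ℝ, ∀ T : Z, μ T = pE f (ρ T x) := by
  let φ : Z →ₗ[ℝ] ℝ := (hD.lin_fun f).mk' _ ∘ₗ (hZ.lin_vec x).mk' _
  refine ⟨φ.clmOfExistsBoundedImage
    ⟨Metric.closedBall 0 1, Metric.closedBall_mem_nhds 0 one_pos, ?_⟩, fun T => rfl⟩
  obtain ⟨u, v, hu, hv, hx⟩ := exists_nonneg_sub_eq x
  obtain ⟨c, d, hcd⟩ := hD.bdd f (-((1 : ℝ) • u)) ((1 : ℝ) • u)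
  obtain ⟨c', d', hcd'⟩ := hD.bdd f (-((1 : ℝ) • v)) ((1 : ℝ) • v)
  refine (NormedSpace.isVonNBounded_of_isBounded ℝ
    (Metric.isBounded_Icc (c - d') (d - c'))).subset ?_
  rintro _ ⟨T, hT, rfl⟩
  have hT' := (hZ.norm_le_iff T 1 zero_le_one).1 (mem_closedBall_zero_iff.1 hT)
  have h := hcd (ρ T u) (hT' u hu).1 (hT' u hu).2
  have h' := hcd' (ρ T v) (hT' v hv).1 (hT' v hv).2
  have hφ : φ T = pE f (ρ T u) - pE f (ρ T v) := by
    change pE f (ρ T x) = _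
    rw [hx, (hZ.central T).1.1.map_sub, (hD.lin_fun f).map_sub]
  rw [hφ]
  constructor <;> linarith

/-- Corollary 1(1).  Let `E` be a Riesz space with point separating order
dual (realized as `D`), `A = Orth(E)` (realized as `O`, so that `Z(A) = Z(E)` is realized
by the single type `Z` acting both on `E` and on `O` compatibly), `m_A : Z(A)'' → Z(A^∼)`
the Arens homomorphism of the bidual of `Z(A)`, `γ : (A^∼)ₙ^∼ → Orth(E^∼)` the Arens
homomorphism of the order bidual of `Orth(E)`, and `m : Z(E)'' → Z(E^∼)` the Arens
homomorphism of the bidual of `Z(E)`.  If `G ∈ (A^∼)ₙ^∼` corresponds, under the natural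
inclusion `Z(A^∼) ⊆ Orth(A^∼) ≅ (A^∼)ₙ^∼` (given by `ν`), to `m_A(F)`, then
`γ(G) = m(F)`; that is, the diagram commutes. -/
theorem statement4
    {E D Z O DO BO : Type*}
    [Lattice E] [AddCommGroup E] [Module ℝ E]
    [CovariantClass E E (· + ·) (· ≤ ·)] [PosSMulMono ℝ E]
    [Lattice D] [AddCommGroup D] [Module ℝ D]
    [CovariantClass D D (· + ·) (· ≤ ·)] [PosSMulMono ℝ D]
    [Lattice Z] [NormedRing Z] [NormedAlgebra ℝ Z]
    [CovariantClass Z Z (· + ·) (· ≤ ·)] [PosSMulMono ℝ Z]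
    [Lattice O] [Ring O] [Module ℝ O]
    [CovariantClass O O (· + ·) (· ≤ ·)] [PosSMulMono ℝ O]
    [Lattice DO] [AddCommGroup DO] [Module ℝ DO]
    [CovariantClass DO DO (· + ·) (· ≤ ·)] [PosSMulMono ℝ DO]
    [Lattice BO] [AddCommGroup BO] [Module ℝ BO]
    [CovariantClass BO BO (· + ·) (· ≤ ·)] [PosSMulMono ℝ BO]
    (pE : D → E → ℝ) (hD : IsOrderDual E D pE) (hsep : SepPoints pE)
    -- `Z` realizes `Z(E)`:
    (ρZ : Z → E → E) (hZ : IsCenterOf E Z ρZ)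
    -- `O` realizes `A = Orth(E)`:
    (ρO : O → E → E) (hO : IsOrthAlg E O ρO)
    (pO : DO → O → ℝ) (hDO : IsOrderDual O DO pO)
    (pB : BO → DO → ℝ) (hBO : IsOrderContinuousDual DO BO pB)
    -- `Z` also realizes `Z(A)`, compatibly (`Z(A) = Z(E)`):
    (ρZO : Z → O → O) (hZO : IsCenterOf O Z ρZO)
    (hcompat : ∀ (T : Z) (π : O) (x : E), ρO (ρZO T π) x = ρZ T (ρO π x))
    -- the Arens homomorphism `m : Z(E)'' → Z(E^∼)`:
    (m : ((Z →L[ℝ] ℝ) →L[ℝ] ℝ) → D → D)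
    (hm : ∀ (F : (Z →L[ℝ] ℝ) →L[ℝ] ℝ) (f : D) (x : E) (μ : Z →L[ℝ] ℝ),
      (∀ T : Z, μ T = pE f (ρZ T x)) → pE (m F f) x = F μ)
    -- the Arens homomorphism `m_A : Z(A)'' → Z(A^∼)`:
    (mA : ((Z →L[ℝ] ℝ) →L[ℝ] ℝ) → DO → DO)
    (hmA : ∀ (F : (Z →L[ℝ] ℝ) →L[ℝ] ℝ) (g : DO) (π : O) (μ : Z →L[ℝ] ℝ),
      (∀ T : Z, μ T = pO g (ρZO T π)) → pO (mA F g) π = F μ)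
    -- the Arens homomorphism `γ : (A^∼)ₙ^∼ → Orth(E^∼)`:
    (γ : BO → D → D)
    (hγ : ∀ (F : BO) (f : D) (x : E) (ψ : DO),
      (∀ π : O, pO ψ π = pE f (ρO π x)) → pE (γ F f) x = pB F ψ) :
    -- commutativity of the diagram: if `G ∈ (A^∼)ₙ^∼` satisfies `ν(G) = m_A(F)`
    -- (i.e. `(G⬝g)(π) = G(g⬝π) = (m_A F g)(π)` for all `g ∈ A^∼`, `π ∈ A`),
    -- then `γ(G) = m(F)`.
    ∀ (F : (Z →L[ℝ] ℝ) →L[ℝ] ℝ) (G : BO),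
      (∀ (g : DO) (π : O) (gπ : DO),
        (∀ σ : O, pO gπ σ = pO g (π * σ)) → pO (mA F g) π = pB G gπ) →
      ∀ f : D, γ G f = m F f := by
  intro F G hG f
  refine hD.inj _ _ fun x => ?_
  obtain ⟨ψ, hψ⟩ := hO.exists_dual_apply hD hDO f x
  obtain ⟨μ, hμ⟩ := hZ.exists_dual_apply hD f x
  have hμ' : ∀ T : Z, μ T = pO ψ (ρZO T 1) := fun T => by
    rw [hμ, hψ, hcompat, hO.map_one]
  rw [hγ G f x ψ hψ, hm F f x μ hμ, ← hG ψ 1 ψ fun σ => by rw [one_mul]]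
  exact hmA F ψ 1 μ hμ'
end

section
/- Let E be a Riesz space with point separating order dual and A = Orth(E). Then γ(Z((A^~)_n^~)) = m(Z(E)''), i.e. the image under the Arens homomorphism γ of the ideal center of the f-algebra (A^~)_n^~ equals the image of Z(E)'' under the Arens homomorphism m. -/
theorem isOrdBdd_of_nonneg {X : Type*} [Lattice X] [AddCommGroup X] [IsOrderedAddMonoid X]
    [Module ℝ X] (φ : X →ₗ[ℝ] ℝ) (h : ∀ a, 0 ≤ a → 0 ≤ φ a) : IsOrdBdd φ := by
  intro a b
  refine ⟨φ a, φ b, fun x hax hxb => ?_⟩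
  have h1 := h _ (sub_nonneg.2 hax)
  have h2 := h _ (sub_nonneg.2 hxb)
  rw [map_sub] at h1 h2
  constructor <;> linarith

section RieszFunctionals

variable {X : Type*} [Lattice X] [AddCommGroup X] [IsOrderedAddMonoid X]
  [Module ℝ X] [PosSMulMono ℝ X]

/-- An additive, positively homogeneous function on the positive cone extends to a linear
functional. -/
theorem exists_linearMap_eq_on_nonneg (φ : X → ℝ)
    (hadd : ∀ a b : X, 0 ≤ a → 0 ≤ b → φ (a + b) = φ a + φ b)
    (hsmul : ∀ (c : ℝ) (a : X), 0 ≤ c → 0 ≤ a → φ (c • a) = c * φ a) :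
    ∃ Φ : X →ₗ[ℝ] ℝ, ∀ a, 0 ≤ a → Φ a = φ a := by
  have key : ∀ a u v : X, 0 ≤ u → 0 ≤ v → a = u - v → φ a⁺ - φ a⁻ = φ u - φ v := by
    intro a u v hu hv h
    have h2 : a⁺ + v = u + a⁻ := by
      have h1 := posPart_sub_negPart a
      rw [sub_eq_iff_eq_add] at h1
      rw [h1, h]; abel
    have h3 := congrArg φ h2
    rw [hadd _ _ (posPart_nonneg a) hv, hadd _ _ hu (negPart_nonneg a)] at h3
    linarith
  refine ⟨{ toFun := fun a => φ a⁺ - φ a⁻, map_add' := ?_, map_smul' := ?_ }, ?_⟩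
  · intro a b
    rw [key (a + b) (a⁺ + b⁺) (a⁻ + b⁻) (add_nonneg (posPart_nonneg a) (posPart_nonneg b))
      (add_nonneg (negPart_nonneg a) (negPart_nonneg b)),
      hadd _ _ (posPart_nonneg a) (posPart_nonneg b),
      hadd _ _ (negPart_nonneg a) (negPart_nonneg b)]
    · ring
    · conv_lhs => rw [← posPart_sub_negPart a, ← posPart_sub_negPart b]
      abel
  · intro c a
    simp only [RingHom.id_apply, smul_eq_mul]
    rcases le_total 0 c with hc | hc
    · rw [key (c • a) (c • a⁺) (c • a⁻) (smul_nonneg hc (posPart_nonneg a))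
        (smul_nonneg hc (negPart_nonneg a)), hsmul _ _ hc (posPart_nonneg a),
        hsmul _ _ hc (negPart_nonneg a)]
      · ring
      · rw [← smul_sub, posPart_sub_negPart]
    · have hc' : 0 ≤ -c := neg_nonneg.2 hc
      rw [key (c • a) ((-c) • a⁻) ((-c) • a⁺) (smul_nonneg hc' (negPart_nonneg a))
        (smul_nonneg hc' (posPart_nonneg a)), hsmul _ _ hc' (posPart_nonneg a),
        hsmul _ _ hc' (negPart_nonneg a)]
      · ring
      · conv_lhs => rw [← posPart_sub_negPart a]
        rw [smul_sub, neg_smul, neg_smul]; abel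
  · intro a ha
    have h := key a a 0 ha le_rfl (sub_zero a).symm
    have h0 : φ 0 = 0 := by simpa using hsmul 0 0 le_rfl le_rfl
    change φ a⁺ - φ a⁻ = φ a
    rw [h, h0, sub_zero]

open scoped Pointwise in
/-- The positive part of an order bounded functional, given by the Riesz–Kantorovich
formula. -/
theorem exists_posPart_of_isOrdBdd (ψ : X →ₗ[ℝ] ℝ) (hψ : IsOrdBdd ψ) :
    ∃ Φ : X →ₗ[ℝ] ℝ, ∀ a, 0 ≤ a → IsLUB (ψ '' Set.Icc 0 a) (Φ a) := by
  have hlub : ∀ a : X, 0 ≤ a → IsLUB (ψ '' Set.Icc 0 a) (sSup (ψ '' Set.Icc 0 a)) := by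
    intro a ha
    obtain ⟨c, d, h⟩ := hψ 0 a
    refine isLUB_csSup ⟨_, 0, ⟨le_rfl, ha⟩, rfl⟩ ⟨d, ?_⟩
    rintro _ ⟨b, hb, rfl⟩
    exact (h b hb.1 hb.2).2
  suffices h : ∃ Φ : X →ₗ[ℝ] ℝ, ∀ a, 0 ≤ a → Φ a = sSup (ψ '' Set.Icc 0 a) by
    obtain ⟨Φ, hΦ⟩ := h
    exact ⟨Φ, fun a ha => (hΦ a ha).symm ▸ hlub a ha⟩
  refine exists_linearMap_eq_on_nonneg (fun a => sSup (ψ '' Set.Icc 0 a)) ?_ ?_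
  · intro a b ha hb
    have hsum : IsLUB (ψ '' Set.Icc 0 a + ψ '' Set.Icc 0 b) _ := (hlub a ha).add (hlub b hb)
    refine (hlub _ (add_nonneg ha hb)).unique ?_
    suffices himg : ψ '' Set.Icc 0 (a + b) = ψ '' Set.Icc 0 a + ψ '' Set.Icc 0 b by
      rwa [himg]
    refine Set.Subset.antisymm ?_ ?_
    · rintro _ ⟨c, ⟨hc0, hc⟩, rfl⟩
      refine ⟨ψ (c ⊓ a), ⟨_, ⟨le_inf hc0 ha, inf_le_right⟩, rfl⟩,
        ψ (c - c ⊓ a), ⟨_, ⟨sub_nonneg.2 inf_le_left, ?_⟩, rfl⟩, ?_⟩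
      · rw [sub_le_comm]
        exact le_inf (sub_le_self _ hb) (sub_le_iff_le_add.2 hc)
      · simp
    · rintro _ ⟨_, ⟨u, hu, rfl⟩, _, ⟨v, hv, rfl⟩, rfl⟩
      exact ⟨u + v, ⟨add_nonneg hu.1 hv.1, add_le_add hu.2 hv.2⟩, map_add ψ u v⟩
  · intro c a hc ha
    rcases hc.eq_or_lt with rfl | hc
    · simp
    · have h := hlub a ha
      refine (hlub _ (smul_nonneg hc.le ha)).unique ⟨?_, ?_⟩
      · rintro _ ⟨b, hb, rfl⟩
        have h1 : ψ (c⁻¹ • b) ≤ _ := h.1 ⟨c⁻¹ • b, ⟨smul_nonneg (inv_nonneg.2 hc.le) hb.1, by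
          simpa [smul_smul, hc.ne'] using
            smul_le_smul_of_nonneg_left hb.2 (inv_nonneg.2 hc.le)⟩, rfl⟩
        rw [map_smul, smul_eq_mul, inv_mul_le_iff₀ hc] at h1
        exact h1
      · intro M hM
        rw [mul_comm, ← le_div_iff₀ hc]
        refine h.2 ?_
        rintro _ ⟨b, hb, rfl⟩
        have h1 : ψ (c • b) ≤ M := hM ⟨c • b, ⟨smul_nonneg hc.le hb.1,
          smul_le_smul_of_nonneg_left hb.2 hc.le⟩, rfl⟩
        rw [map_smul, smul_eq_mul] at h1
        rw [le_div_iff₀ hc]; linarith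

/-- The infimum of a downward directed family of positive functionals is computed pointwise
on the positive cone. -/
theorem exists_linearMap_isGLB {ι : Type*} [Nonempty ι] (p : ι → X →ₗ[ℝ] ℝ)
    (hpos : ∀ i a, 0 ≤ a → 0 ≤ p i a)
    (hdir : ∀ i j, ∃ k, ∀ a, 0 ≤ a → p k a ≤ p i a ∧ p k a ≤ p j a) :
    ∃ Φ : X →ₗ[ℝ] ℝ, ∀ a, 0 ≤ a → IsGLB (Set.range fun i => p i a) (Φ a) := by
  have hglb : ∀ a : X, 0 ≤ a → IsGLB (Set.range fun i => p i a) (⨅ i, p i a) := by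
    intro a ha
    refine isGLB_ciInf ⟨0, ?_⟩
    rintro _ ⟨i, rfl⟩
    exact hpos i a ha
  suffices h : ∃ Φ : X →ₗ[ℝ] ℝ, ∀ a, 0 ≤ a → Φ a = ⨅ i, p i a by
    obtain ⟨Φ, hΦ⟩ := h
    exact ⟨Φ, fun a ha => (hΦ a ha).symm ▸ hglb a ha⟩
  refine exists_linearMap_eq_on_nonneg (fun a => ⨅ i, p i a) ?_ ?_
  · intro a b ha hb
    refine (hglb _ (add_nonneg ha hb)).unique ⟨?_, ?_⟩
    · rintro _ ⟨i, rfl⟩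
      simp only [map_add]
      exact add_le_add ((hglb a ha).1 ⟨i, rfl⟩) ((hglb b hb).1 ⟨i, rfl⟩)
    · intro M hM
      have h1 : ∀ i j, M ≤ p i a + p j b := by
        intro i j
        obtain ⟨k, hk⟩ := hdir i j
        have h2 : M ≤ p k (a + b) := hM ⟨k, rfl⟩
        rw [map_add] at h2
        linarith [(hk a ha).1, (hk b hb).2]
      have h2 : ∀ i, M - p i a ≤ ⨅ j, p j b := fun i => le_ciInf fun j => by linarith [h1 i j]
      have h3 : M - (⨅ j, p j b) ≤ ⨅ i, p i a := le_ciInf fun i => by linarith [h2 i]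
      linarith
  · intro c a hc _
    simp only [map_smul, smul_eq_mul]
    exact (Real.mul_iInf_of_nonneg hc _).symm

end RieszFunctionals

/-- A functional dominated by `c‖R ·‖` factors through `R` as a continuous functional. -/
theorem exists_continuous_factorization {V W : Type*} [AddCommGroup V] [Module ℝ V]
    [NormedAddCommGroup W] [NormedSpace ℝ W] (R : V →ₗ[ℝ] W) (F : V →ₗ[ℝ] ℝ) (c : ℝ)
    (h : ∀ v, |F v| ≤ c * ‖R v‖) : ∃ G : W →L[ℝ] ℝ, ∀ v, G (R v) = F v := by
  obtain ⟨g, hg⟩ := R.rangeRestrict.exists_rightInverse_of_surjective R.range_rangeRestrict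
  have hRg : ∀ y : LinearMap.range R, R (g y) = y := fun y =>
    congrArg Subtype.val (LinearMap.congr_fun hg y)
  let f : LinearMap.range R →L[ℝ] ℝ := (F.comp g).mkContinuous c fun y => by
    have := h (g y)
    rw [hRg] at this
    exact this
  obtain ⟨G, hG, -⟩ := exists_extension_norm_eq _ f
  refine ⟨G, fun v => ?_⟩
  have h1 : G (R v) = F (g (R.rangeRestrict v)) := hG (R.rangeRestrict v)
  have h2 := h (g (R.rangeRestrict v) - v)
  have h3 : R (g (R.rangeRestrict v) - v) = 0 := by rw [map_sub, hRg]; simp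
  rw [h3, norm_zero, mul_zero, map_sub] at h2
  rw [h1]
  exact sub_eq_zero.1 (abs_nonpos_iff.1 h2)

section Realizations

variable {E Z O : Type*} [Lattice E] [AddCommGroup E] [Module ℝ E] [Lattice Z] [NormedRing Z] [NormedAlgebra ℝ Z]
  [Lattice O] [Ring O] [Module ℝ O] {ρZ : Z → E → E} {ρO : O → E → E}

/-- The embedding of the ideal center into the algebra of orthomorphisms. -/
theorem exists_center_embedding (hZ : IsCenterOf E Z ρZ) (hO : IsOrthAlg E O ρO) :
    ∃ j : Z →ₗ[ℝ] O, (∀ a x, ρO (j a) x = ρZ a x) ∧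
      (∀ a, j a ≤ ‖a‖ • 1 ∧ -(‖a‖ • 1) ≤ j a) ∧
      ∀ b : O, b ≤ 1 → -1 ≤ b → ∃ a, j a = b ∧ ‖a‖ ≤ 1 := by
  have hneg : ∀ (b : O) (x : E), ρO (-b) x = -ρO b x := fun b x => (hO.lin_vec x).map_neg b
  have hone : ∀ (c : ℝ) (x : E), ρO (c • 1) x = c • x := fun c x => by
    rw [(hO.lin_vec x).map_smul, hO.map_one]
  choose j hj using fun a : Z => hO.surj (ρZ a) (hZ.central a).1
  refine ⟨{ toFun := j, map_add' := ?_, map_smul' := ?_ }, hj, ?_, ?_⟩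
  · intro a b
    refine hO.inj _ _ fun x => ?_
    rw [hj, (hZ.lin_vec x).map_add, (hO.lin_vec x).map_add, hj, hj]
  · intro c a
    refine hO.inj _ _ fun x => ?_
    rw [hj, (hZ.lin_vec x).map_smul, RingHom.id_apply, (hO.lin_vec x).map_smul, hj]
  · intro a
    have h := (hZ.norm_le_iff a ‖a‖ (norm_nonneg a)).1 le_rfl
    refine ⟨(hO.le_iff _ _).2 fun x hx => ?_, (hO.le_iff _ _).2 fun x hx => ?_⟩
    · rw [hone]; exact (hj a x).le.trans (h x hx).2
    · rw [hneg, hone]; exact (h x hx).1.trans (hj a x).ge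
  · intro b hb1 hb2
    have h : ∀ x : E, 0 ≤ x → -((1 : ℝ) • x) ≤ ρO b x ∧ ρO b x ≤ (1 : ℝ) • x := by
      intro x hx
      have h1 := (hO.le_iff _ _).1 hb1 x hx
      have h2 := (hO.le_iff _ _).1 hb2 x hx
      rw [hO.map_one] at h1
      rw [hneg, hO.map_one] at h2
      rw [one_smul]
      exact ⟨h2, h1⟩
    obtain ⟨a, ha⟩ := hZ.surj (ρO b) ⟨hO.ortho b, 1, h⟩
    refine ⟨a, hO.inj _ _ fun x => (hj a x).trans (ha x),
      (hZ.norm_le_iff a 1 zero_le_one).2 fun x hx => ?_⟩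
    rw [ha]
    exact h x hx

/-- `ψ_{x,f} : π ↦ f(πx)` belongs to the order dual of `Orth(E)`. -/
theorem exists_orbit_functional [IsOrderedAddMonoid E]
    {D DO : Type*} [Lattice D] [AddCommGroup D] [Module ℝ D]
    [Lattice DO] [AddCommGroup DO] [Module ℝ DO] {pE : D → E → ℝ} {pO : DO → O → ℝ}
    (hD : IsOrderDual E D pE) (hO : IsOrthAlg E O ρO) (hDO : IsOrderDual O DO pO)
    (f : D) (x : E) : ∃ ψ : DO, ∀ π, pO ψ π = pE f (ρO π x) := by
  refine hDO.surj _ ⟨fun a b => ?_, fun c a => ?_⟩ fun a b => ?_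
  · rw [(hO.lin_vec x).map_add, (hD.lin_fun f).map_add]
  · rw [(hO.lin_vec x).map_smul, (hD.lin_fun f).map_smul]
  · obtain ⟨c₁, d₁, h₁⟩ := hD.bdd f (ρO a x⁺) (ρO b x⁺)
    obtain ⟨c₂, d₂, h₂⟩ := hD.bdd f (ρO a x⁻) (ρO b x⁻)
    refine ⟨c₁ - d₂, d₁ - c₂, fun π hπ hπ' => ?_⟩
    have e : pE f (ρO π x) = pE f (ρO π x⁺) - pE f (ρO π x⁻) := by
      conv_lhs => rw [← posPart_sub_negPart x]
      rw [(hO.ortho π).1.map_sub, (hD.lin_fun f).map_sub]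
    have k₁ := h₁ _ ((hO.le_iff _ _).1 hπ _ (posPart_nonneg x))
      ((hO.le_iff _ _).1 hπ' _ (posPart_nonneg x))
    have k₂ := h₂ _ ((hO.le_iff _ _).1 hπ _ (negPart_nonneg x))
      ((hO.le_iff _ _).1 hπ' _ (negPart_nonneg x))
    rw [e]
    constructor <;> linarith [k₁.1, k₁.2, k₂.1, k₂.2]

end Realizations

section OrderDual

variable {X D : Type*} [Lattice X] [AddCommGroup X] [Module ℝ X] [Lattice D] [AddCommGroup D] [Module ℝ D]
  {p : D → X → ℝ}

theorem IsOrderDual.nonneg_iff_s5 (hD : IsOrderDual X D p) (f : D) :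
    0 ≤ f ↔ ∀ x, 0 ≤ x → 0 ≤ p f x := by
  rw [hD.le_iff]
  simp only [(hD.lin_vec _).map_zero]

/-- Jordan decomposition with control of the total mass at a positive element `e`. -/
theorem IsOrderDual.exists_decomposition [IsOrderedAddMonoid X] [PosSMulMono ℝ X]
    (hD : IsOrderDual X D p) (f : D) {e : X}
    (he : 0 ≤ e) {M : ℝ} (hM : ∀ b, b ≤ e → -e ≤ b → p f b ≤ M) :
    ∃ g h : D, (∀ x, 0 ≤ x → 0 ≤ p g x) ∧ (∀ x, 0 ≤ x → 0 ≤ p h x) ∧ f = g - h ∧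
      p g e + p h e ≤ M := by
  obtain ⟨Φ, hΦ⟩ := exists_posPart_of_isOrdBdd ((hD.lin_fun f).mk' _) (hD.bdd f)
  have hΦ0 : ∀ a, 0 ≤ a → 0 ≤ Φ a := fun a ha =>
    (hΦ a ha).1 ⟨0, ⟨le_rfl, ha⟩, (hD.lin_fun f).map_zero⟩
  have hΦf : ∀ a, 0 ≤ a → p f a ≤ Φ a := fun a ha => (hΦ a ha).1 ⟨a, ⟨ha, le_rfl⟩, rfl⟩
  obtain ⟨g, hg⟩ := hD.surj Φ Φ.isLinear (isOrdBdd_of_nonneg Φ hΦ0)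
  have hsub : ∀ x, p (g - f) x = p g x - p f x := fun x => (hD.lin_vec x).map_sub g f
  refine ⟨g, g - f, fun x hx => (hΦ0 x hx).trans_eq (hg x).symm, fun x hx => ?_, by abel, ?_⟩
  · rw [hsub, hg]
    exact sub_nonneg.2 (hΦf x hx)
  · have h : Φ e ≤ (M + p f e) / 2 := by
      refine (hΦ e he).2 ?_
      rintro _ ⟨b, ⟨hb0, hbe⟩, rfl⟩
      have h1 := hM (b + b - e) (by
        rw [sub_le_iff_le_add]; exact add_le_add hbe hbe) (by
        rw [le_sub_iff_add_le, neg_add_cancel]; exact add_nonneg hb0 hb0)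
      rw [(hD.lin_fun f).map_sub, (hD.lin_fun f).map_add] at h1
      change p f b ≤ _
      linarith
    rw [hsub, hg]
    linarith

/-- A downward directed set with infimum `0` in an order dual tends to `0` pointwise. -/
theorem IsOrderDual.exists_apply_lt [IsOrderedAddMonoid X] [PosSMulMono ℝ X]
    (hD : IsOrderDual X D p) {s : Set D} (hs : s.Nonempty)
    (hdir : DirectedOn (· ≥ ·) s) (hglb : IsGLB s 0) {e : X} (he : 0 ≤ e) {ε : ℝ}
    (hε : 0 < ε) : ∃ f ∈ s, p f e < ε := by
  have : Nonempty s := hs.to_subtype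
  obtain ⟨Φ, hΦ⟩ := exists_linearMap_isGLB (fun i : s => (hD.lin_fun i.1).mk' _)
    (fun i => (hD.nonneg_iff_s5 i.1).1 (hglb.1 i.2)) (fun i j => by
      obtain ⟨k, hk, hki, hkj⟩ := hdir i.1 i.2 j.1 j.2
      exact ⟨⟨k, hk⟩, fun a ha => ⟨(hD.le_iff _ _).1 hki a ha, (hD.le_iff _ _).1 hkj a ha⟩⟩)
  have hΦ0 : ∀ a, 0 ≤ a → 0 ≤ Φ a := by
    intro a ha
    refine (hΦ a ha).2 ?_
    rintro _ ⟨i, rfl⟩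
    exact (hD.nonneg_iff_s5 i.1).1 (hglb.1 i.2) a ha
  obtain ⟨g, hg⟩ := hD.surj Φ Φ.isLinear (isOrdBdd_of_nonneg Φ hΦ0)
  have hg0 : g ≤ 0 := hglb.2 fun f hf => (hD.le_iff _ _).2 fun x hx => by
    rw [hg]; exact (hΦ x hx).1 ⟨⟨f, hf⟩, rfl⟩
  have hge : Φ e ≤ 0 := by
    have := (hD.le_iff _ _).1 hg0 e he
    rwa [hg, (hD.lin_vec e).map_zero] at this
  by_contra! hcon
  have : ε ≤ Φ e := (hΦ e he).2 (by rintro _ ⟨i, rfl⟩; exact hcon i.1 i.2)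
  linarith

/-- A linear functional on an order dual dominated on positive elements by a multiple of an
evaluation is order bounded. -/
theorem IsOrderDual.isOrdBdd_of_le_apply [IsOrderedAddMonoid D] (hD : IsOrderDual X D p)
    (Φ : D →ₗ[ℝ] ℝ) {K : ℝ} (hK : 0 ≤ K) {e : X} (he : 0 ≤ e)
    (h : ∀ f, 0 ≤ f → |Φ f| ≤ K * p f e) : IsOrdBdd Φ := by
  intro a b
  refine ⟨Φ a - K * (p b e - p a e), Φ a + K * (p b e - p a e), fun f haf hfb => ?_⟩
  have h1 := h _ (sub_nonneg.2 haf)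
  rw [map_sub, (hD.lin_vec e).map_sub, abs_le] at h1
  have h2 := mul_le_mul_of_nonneg_left (sub_le_sub_right ((hD.le_iff _ _).1 hfb e he) (p a e)) hK
  constructor <;> linarith [h1.1, h1.2]

/-- A functional on an order dual dominated on positive elements by a multiple of an
evaluation is order continuous. -/
theorem IsOrderDual.isOrderContinuousFun_of_le_apply [IsOrderedAddMonoid X] [PosSMulMono ℝ X]
    (hD : IsOrderDual X D p)
    (Φ : D → ℝ) {K : ℝ} (hK : 0 ≤ K) {e : X} (he : 0 ≤ e)
    (h : ∀ f, 0 ≤ f → |Φ f| ≤ K * p f e) : IsOrderContinuousFun Φ := by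
  intro s hs hdir hglb ε hε
  obtain ⟨f, hf, hfe⟩ := hD.exists_apply_lt hs hdir hglb he
    (div_pos hε (by linarith : 0 < K + 1))
  refine ⟨f, hf, fun g hg hgf => ?_⟩
  have h1 := h g (hglb.1 hg)
  have h2 := (hD.le_iff _ _).1 hgf e he
  have h3 := (hD.nonneg_iff_s5 f).1 (hglb.1 hf) e he
  rw [lt_div_iff₀ (by linarith)] at hfe
  nlinarith [mul_le_mul_of_nonneg_left h2 hK]

end OrderDual

/-- Corollary 1(2).  Let `E` be a Riesz space with point separating
order dual (realized as `D`) and `A = Orth(E)` (realized as `O`).  Then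
`γ(Z((A^∼)ₙ^∼)) = m(Z(E)'')`: the image under the Arens homomorphism `γ` of the ideal
center of the Arens `f`-algebra `(A^∼)ₙ^∼` (realized as `BO`, the order ideal generated
by its unit) equals the image of `Z(E)''` under the Arens homomorphism `m`. -/
theorem statement5
    {E D Z O DO BO : Type*}
    [Lattice E] [AddCommGroup E] [Module ℝ E]
    [CovariantClass E E (· + ·) (· ≤ ·)] [PosSMulMono ℝ E]
    [Lattice D] [AddCommGroup D] [Module ℝ D]
    [CovariantClass D D (· + ·) (· ≤ ·)] [PosSMulMono ℝ D]
    [Lattice Z] [NormedRing Z] [NormedAlgebra ℝ Z]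
    [CovariantClass Z Z (· + ·) (· ≤ ·)] [PosSMulMono ℝ Z]
    [Lattice O] [Ring O] [Module ℝ O]
    [CovariantClass O O (· + ·) (· ≤ ·)] [PosSMulMono ℝ O]
    [Lattice DO] [AddCommGroup DO] [Module ℝ DO]
    [CovariantClass DO DO (· + ·) (· ≤ ·)] [PosSMulMono ℝ DO]
    [Lattice BO] [Ring BO] [Module ℝ BO]
    [CovariantClass BO BO (· + ·) (· ≤ ·)] [PosSMulMono ℝ BO]
    (pE : D → E → ℝ) (hD : IsOrderDual E D pE) (hsep : SepPoints pE)
    (ρZ : Z → E → E) (hZ : IsCenterOf E Z ρZ)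
    (ρO : O → E → E) (hO : IsOrthAlg E O ρO)
    (pO : DO → O → ℝ) (hDO : IsOrderDual O DO pO)
    (pB : BO → DO → ℝ) (hBO : IsOrderContinuousDual DO BO pB)
    (hArens : IsArensAlgebra pO pB)
    -- the Arens homomorphism `γ : (A^∼)ₙ^∼ → Orth(E^∼)`:
    (γ : BO → D → D)
    (hγ : ∀ (F : BO) (f : D) (x : E) (ψ : DO),
      (∀ π : O, pO ψ π = pE f (ρO π x)) → pE (γ F f) x = pB F ψ)
    -- the Arens homomorphism `m : Z(E)'' → Z(E^∼)`:
    (m : ((Z →L[ℝ] ℝ) →L[ℝ] ℝ) → D → D)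
    (hm : ∀ (F : (Z →L[ℝ] ℝ) →L[ℝ] ℝ) (f : D) (x : E) (μ : Z →L[ℝ] ℝ),
      (∀ T : Z, μ T = pE f (ρZ T x)) → pE (m F f) x = F μ) :
    -- `γ(Z((A^∼)ₙ^∼)) = m(Z(E)'')`:
    γ '' {F : BO | ∃ c : ℝ, 0 ≤ c ∧ |F| ≤ c • (1 : BO)} = Set.range m := by
  have : IsOrderedAddMonoid E := { add_le_add_left := fun a b h c => add_le_add_left h c }
  have : IsOrderedAddMonoid O := { add_le_add_left := fun a b h c => add_le_add_left h c }
  have : IsOrderedAddMonoid DO := { add_le_add_left := fun a b h c => add_le_add_left h c }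
  obtain ⟨j, hj, hjle, hjsurj⟩ := exists_center_embedding hZ hO
  have h01 : (0 : O) ≤ 1 := (hO.le_iff _ _).2 fun x hx => by
    rwa [(hO.lin_vec x).map_zero, hO.map_one]
  have hpos : ∀ ψ : DO, (∀ a, 0 ≤ a → 0 ≤ pO ψ a) → ∀ a : Z, |pO ψ (j a)| ≤ pO ψ 1 * ‖a‖ := by
    intro ψ hψ a
    have h1 := hψ _ (sub_nonneg.2 (hjle a).1)
    have h2 := hψ _ (sub_nonneg.2 (hjle a).2)
    rw [(hDO.lin_fun ψ).map_sub, (hDO.lin_fun ψ).map_smul, smul_eq_mul] at h1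
    rw [(hDO.lin_fun ψ).map_sub, (hDO.lin_fun ψ).map_neg, (hDO.lin_fun ψ).map_smul,
      smul_eq_mul] at h2
    rw [abs_le]
    constructor <;> linarith
  have hcont : ∀ ψ : DO, ∃ C : ℝ, ∀ a : Z, ‖pO ψ (j a)‖ ≤ C * ‖a‖ := by
    intro ψ
    obtain ⟨c, d, hcd⟩ := hDO.bdd ψ (-1) 1
    obtain ⟨g, h, hg, hh, rfl, -⟩ := hDO.exists_decomposition ψ h01
      fun b hb hb' => (hcd b hb' hb).2
    refine ⟨pO g 1 + pO h 1, fun a => ?_⟩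
    rw [(hDO.lin_vec (j a)).map_sub, add_mul, Real.norm_eq_abs]
    exact (abs_sub _ _).trans (add_le_add (hpos g hg a) (hpos h hh a))
  choose C hC using hcont
  let R : DO →ₗ[ℝ] Z →L[ℝ] ℝ :=
    { toFun := fun ψ => (((hDO.lin_fun ψ).mk' _).comp j).mkContinuous (C ψ) (hC ψ)
      map_add' := fun ψ ψ' => by
        ext a
        exact (hDO.lin_vec (j a)).map_add ψ ψ'
      map_smul' := fun c ψ => by
        ext a
        exact (hDO.lin_vec (j a)).map_smul c ψ }
  have hR : ∀ ψ a, R ψ a = pO ψ (j a) := fun _ _ => rfl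
  have hpair : ∀ (F : BO) (G : (Z →L[ℝ] ℝ) →L[ℝ] ℝ), (∀ ψ, G (R ψ) = pB F ψ) →
      γ F = m G := by
    intro F G hFG
    funext f
    refine hD.inj _ _ fun x => ?_
    obtain ⟨ψ, hψ⟩ := exists_orbit_functional hD hO hDO f x
    rw [hγ F f x ψ hψ, hm G f x (R ψ) fun T => by rw [hR, hψ, hj], hFG]
  ext S
  constructor
  · rintro ⟨F, ⟨c, hc, hF⟩, rfl⟩
    have hB : ∀ ψ : DO, (∀ a, 0 ≤ a → 0 ≤ pO ψ a) → |pB F ψ| ≤ c * pO ψ 1 := by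
      intro ψ hψ
      have hψ0 := (hDO.nonneg_iff_s5 ψ).2 hψ
      have h1 := (hBO.le_iff _ _).1 ((le_abs_self F).trans hF) ψ hψ0
      have h2 := (hBO.le_iff _ _).1 ((neg_le_abs F).trans hF) ψ hψ0
      rw [(hBO.lin_vec ψ).map_smul, hArens.one_def, smul_eq_mul] at h1 h2
      rw [(hBO.lin_vec ψ).map_neg] at h2
      exact abs_le.2 ⟨by linarith, h1⟩
    obtain ⟨G, hG⟩ := exists_continuous_factorization R ((hBO.lin_fun F).mk' _) c (by
      intro ψ
      obtain ⟨g, h, hg, hh, hgh, hM⟩ := hDO.exists_decomposition ψ h01 (M := ‖R ψ‖) (by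
        intro b hb hb'
        obtain ⟨a, rfl, ha⟩ := hjsurj b hb hb'
        exact (le_abs_self _).trans (((R ψ).le_opNorm a).trans
          (mul_le_of_le_one_right (norm_nonneg _) ha)))
      change |pB F ψ| ≤ _
      have e : pB F ψ = pB F g - pB F h := by rw [hgh, (hBO.lin_fun F).map_sub]
      rw [e]
      calc |pB F g - pB F h| ≤ |pB F g| + |pB F h| := abs_sub _ _
        _ ≤ c * pO g 1 + c * pO h 1 := add_le_add (hB g hg) (hB h hh)
        _ = c * (pO g 1 + pO h 1) := by ring
        _ ≤ c * ‖R ψ‖ := mul_le_mul_of_nonneg_left hM hc)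
    exact ⟨G, (hpair F G hG).symm⟩
  · rintro ⟨G, rfl⟩
    have hG : ∀ ψ : DO, 0 ≤ ψ → |G (R ψ)| ≤ ‖G‖ * pO ψ 1 := by
      intro ψ hψ
      have hψ' := (hDO.nonneg_iff_s5 ψ).1 hψ
      exact (G.le_opNorm _).trans (mul_le_mul_of_nonneg_left
        ((R ψ).opNorm_le_bound (hψ' 1 h01) (hpos ψ hψ')) (norm_nonneg G))
    obtain ⟨F, hF⟩ := hBO.surj (G.toLinearMap.comp R) (LinearMap.isLinear _)
      (hDO.isOrdBdd_of_le_apply (G.toLinearMap.comp R) (norm_nonneg G) h01 hG)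
      (hDO.isOrderContinuousFun_of_le_apply _ (norm_nonneg G) h01 hG)
    refine ⟨F, ⟨‖G‖, norm_nonneg G, ?_⟩, hpair F G fun ψ => (hF ψ).symm⟩
    refine sup_le ((hBO.le_iff _ _).2 fun ψ hψ => ?_) ((hBO.le_iff _ _).2 fun ψ hψ => ?_)
    · rw [(hBO.lin_vec ψ).map_smul, hArens.one_def, smul_eq_mul, hF]
      exact (le_abs_self _).trans (hG ψ hψ)
    · rw [(hBO.lin_vec ψ).map_smul, (hBO.lin_vec ψ).map_neg, hArens.one_def, smul_eq_mul, hF]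
      exact (neg_le_abs _).trans (hG ψ hψ)
end
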